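/- arXiv:2301.13040 — 2 statements merged into one kernel-verified Lean document; each statement's English description precedes it below -/
import Mathlib

section
/- Let k be a field, let n ≥ 1, and let f, g ∈ k[x_0, …, x_n] be homogeneous polynomials of the same degree d ≥ 1, regarded also as homogeneous polynomials in k[x_0, …, x_{n+1}]. If the hypersurfaces V(f) ⊆ P^{n+1} and V(g) ⊆ P^{n+1} are isomorphic as varieties, then the hypersurfaces V(f) ⊆ P^n and V(g) ⊆ P^n are isomorphic as varieties. -/
/-!
Common set-up: projective `n`-space over a field `k` as the scheme
`Proj k[x_0, …, x_n]`, complements of hypersurfaces as open subschemes,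
hypersurfaces as reduced closed subschemes, and isomorphisms of varieties
over `k` as scheme isomorphisms commuting with the structure morphisms
to `Spec k`.
-/

open AlgebraicGeometry CategoryTheory MvPolynomial

attribute [local instance] MvPolynomial.gradedAlgebra

noncomputable section

/-- The standard grading on the polynomial ring `k[x_0, …, x_n]`. -/
abbrev grading (k : Type) [Field k] (n : ℕ) := homogeneousSubmodule (Fin (n + 1)) k

/-- Projective `n`-space over `k`, as a scheme. -/
abbrev ProjSpace (k : Type) [Field k] (n : ℕ) : Scheme := Proj (grading k n)

/-- The base scheme `Spec k`. -/
abbrev SpecK (k : Type) [Field k] : Scheme := Spec (CommRingCat.of k)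

/-- The structure morphism `ℙⁿ_k ⟶ Spec k`. -/
abbrev projStruct (k : Type) [Field k] (n : ℕ) : ProjSpace k n ⟶ SpecK k :=
  Proj.toSpecZero (grading k n) ≫
    Spec.map (CommRingCat.ofHom (algebraMap k ((grading k n) 0)))

/-- The open complement `ℙⁿ_f = ℙⁿ ∖ V(f)` of the hypersurface `V(f)`, as a scheme. -/
abbrev PnF (k : Type) [Field k] (n : ℕ) (f : MvPolynomial (Fin (n + 1)) k) : Scheme :=
  (Proj.basicOpen (grading k n) f).toScheme

/-- The structure morphism `ℙⁿ_f ⟶ Spec k`. -/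
abbrev PnFStruct (k : Type) [Field k] (n : ℕ) (f : MvPolynomial (Fin (n + 1)) k) :
    PnF k n f ⟶ SpecK k :=
  (Proj.basicOpen (grading k n) f).ι ≫ projStruct k n

/-- Two schemes equipped with structure morphisms to a common base are isomorphic over
that base.  For varieties over `k` (with base `Spec k`) this is the usual notion of
isomorphism of varieties over `k`. -/
def IsoOver {X Y B : Scheme} (sX : X ⟶ B) (sY : Y ⟶ B) : Prop :=
  ∃ e : X ≅ Y, e.hom ≫ sY = sX

/-- The set of points of `ℙⁿ` where `f` vanishes. -/
def zeroLocusSet (k : Type) [Field k] (n : ℕ) (f : MvPolynomial (Fin (n + 1)) k) :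
    Set (ProjSpace k n) :=
  {x | f ∈ (x : ProjectiveSpectrum (grading k n)).asHomogeneousIdeal}

/-- `ι : H ⟶ ℙⁿ` realizes the scheme `H` as the hypersurface `V(f) ⊆ ℙⁿ`, i.e. as the
reduced closed subscheme of `ℙⁿ` whose underlying set is the zero locus of `f`. -/
structure IsHypersurface {k : Type} [Field k] {n : ℕ} (f : MvPolynomial (Fin (n + 1)) k)
    (H : Scheme) (ι : H ⟶ ProjSpace k n) : Prop where
  isClosedImmersion : IsClosedImmersion ι
  reduced : IsReduced H
  range_eq : Set.range ι.base = zeroLocusSet k n f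

/-- `r` generates the radical of the principal ideal `(f)`. -/
def IsRadicalGenerator {R : Type*} [CommRing R] (f r : R) : Prop :=
  ∀ s, r ∣ s ↔ ∃ m : ℕ, f ∣ s ^ m

theorem exists_isRadicalGenerator {R : Type*} [CommRing R] [IsDomain R]
    [UniqueFactorizationMonoid R] {f : R} (hf : f ≠ 0) : ∃ r, IsRadicalGenerator f r := by
  obtain ⟨i⟩ : Nonempty (StrongNormalizationMonoid R) := inferInstance
  exact ⟨UniqueFactorizationMonoid.radical f, fun s ↦
    (UniqueFactorizationMonoid.exists_dvd_pow_iff_radical_dvd hf).symm⟩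

namespace IsRadicalGenerator

variable {R : Type*} [CommRing R] {f r : R}

theorem dvd (h : IsRadicalGenerator f r) : r ∣ f := (h f).2 ⟨1, by simp⟩

theorem dvd_pow (h : IsRadicalGenerator f r) : ∃ m : ℕ, f ∣ r ^ m := (h r).1 dvd_rfl

theorem ne_zero (h : IsRadicalGenerator f r) (hf : f ≠ 0) : r ≠ 0 := by
  rintro rfl
  exact hf (zero_dvd_iff.1 h.dvd)

theorem mem_radical_iff (h : IsRadicalGenerator f r) (s : R) :
    s ∈ (Ideal.span {f}).radical ↔ r ∣ s := by
  simp [Ideal.mem_radical_iff, Ideal.mem_span_singleton, h s]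

end IsRadicalGenerator

namespace MvPolynomial

variable {σ : Type*} {k : Type*} [Field k]

theorem _root_.IsRadicalGenerator.isHomogeneous {f r : MvPolynomial σ k} {d : ℕ}
    (h : IsRadicalGenerator f r) (hf : f ≠ 0) (hfd : f.IsHomogeneous d) :
    r.IsHomogeneous r.totalDegree := by
  classical
  have hr : r ≠ 0 := h.ne_zero hf
  have hI : (Ideal.span {f}).radical.IsHomogeneous (homogeneousSubmodule σ k) := by
    apply Ideal.IsHomogeneous.radical
    apply Ideal.homogeneous_span
    rintro x rfl
    exact ⟨d, hfd⟩
  have hcomp : ∀ n, r ∣ homogeneousComponent n r := fun n ↦ (h.mem_radical_iff _).1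
    (homogeneousComponent_mem_of_mem hI ((h.mem_radical_iff _).2 dvd_rfl) n)
  obtain ⟨s, hs, hsd⟩ : ∃ s ∈ r.support, s.degree = r.totalDegree := by
    obtain ⟨s, hs, hs'⟩ := Finset.exists_mem_eq_sup r.support
      (Finset.nonempty_iff_ne_empty.2 (by simpa using hr)) (fun s ↦ s.sum fun _ e ↦ e)
    exact ⟨s, hs, by rw [MvPolynomial.totalDegree, hs']; rfl⟩
  obtain ⟨c, hc⟩ := hcomp r.totalDegree
  have hne : homogeneousComponent r.totalDegree r ≠ 0 := by
    intro h0
    have := coeff_homogeneousComponent r.totalDegree r s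
    rw [h0, if_pos hsd] at this
    exact (mem_support_iff.1 hs) (by simpa using this.symm)
  have hc0 : c ≠ 0 := by rintro rfl; exact hne (by simpa using hc)
  have hdeg := (homogeneousComponent_isHomogeneous r.totalDegree r).totalDegree hne
  rw [hc, totalDegree_mul_of_isDomain hr hc0] at hdeg
  have hc' : c = C (coeff 0 c) := (totalDegree_eq_zero_iff_eq_C).1 (by omega)
  have hu : coeff 0 c ≠ 0 := by intro h0; apply hc0; rw [hc', h0, C_0]
  have hr' : r = C (coeff 0 c)⁻¹ * homogeneousComponent r.totalDegree r := by
    rw [hc, hc', mul_left_comm, coeff_C, if_pos rfl, ← C_mul, inv_mul_cancel₀ hu]; simp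
  rw [hr']
  have := (homogeneousComponent_isHomogeneous r.totalDegree r).C_mul (coeff 0 c)⁻¹
  rwa [← hr'] at this ⊢

theorem mem_idealOfVars_iff (p : MvPolynomial σ k) :
    p ∈ idealOfVars σ k ↔ constantCoeff p = 0 := by
  rw [← pow_one (idealOfVars σ k), mem_pow_idealOfVars_iff']
  constructor
  · intro h; exact h 0 (by simp)
  · intro h x hx
    have : x = 0 := (Finsupp.degree_eq_zero_iff x).1 (Nat.lt_one_iff.1 hx)
    rw [this]; exact h

theorem IsHomogeneous.mem_pow_idealOfVars {p : MvPolynomial σ k} {d : ℕ}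
    (hp : p.IsHomogeneous d) :
    p ∈ idealOfVars σ k ^ d :=
  (mem_pow_idealOfVars_iff' d p).2 fun _ hx ↦ hp.coeff_eq_zero hx.ne

theorem IsHomogeneous.eq_zero_of_mem_pow {p : MvPolynomial σ k} {d : ℕ} (hp : p.IsHomogeneous d)
    (h : p ∈ idealOfVars σ k ^ (d + 1)) : p = 0 := by
  ext x
  by_cases hx : x.degree = d
  · exact (mem_pow_idealOfVars_iff' _ p).1 h x (by omega)
  · exact hp.coeff_eq_zero hx

theorem isHomogeneous_of_mem_pow {p : MvPolynomial σ k} {d : ℕ} (h : p ∈ idealOfVars σ k ^ d)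
    (hd : p.totalDegree ≤ d) : p.IsHomogeneous d := by
  intro x hx
  have h1 := (mem_pow_idealOfVars_iff d p).1 h x (mem_support_iff.2 hx)
  have h2 := le_totalDegree (mem_support_iff.2 hx)
  have h3 : x.degree = d := le_antisymm (h2.trans hd) h1
  rw [← h3, Finsupp.degree_eq_weight_one]
  rfl

theorem exists_mul_sub_one_mem_pow {u : MvPolynomial σ k} (hu : constantCoeff u ≠ 0) (j : ℕ) :
    ∃ v, v * u - 1 ∈ idealOfVars σ k ^ j := by
  set c := constantCoeff u
  set w := 1 - C c⁻¹ * u with hw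
  have hwM : w ∈ idealOfVars σ k := by
    rw [mem_idealOfVars_iff]; simp [hw, c, inv_mul_cancel₀ hu]
  refine ⟨(∑ i ∈ Finset.range j, w ^ i) * C c⁻¹, ?_⟩
  have : (∑ i ∈ Finset.range j, w ^ i) * C c⁻¹ * u - 1 = - w ^ j := by
    have h1 := geom_sum_mul w j
    have h2 : w - 1 = - (C c⁻¹ * u) := by rw [hw]; ring
    rw [h2] at h1
    linear_combination -h1
  rw [this]
  exact neg_mem (Ideal.pow_mem_pow hwM j)

theorem map_pow_idealOfVars_le {τ : Type*} (Φ : MvPolynomial σ k →ₐ[k] MvPolynomial τ k)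
    (hΦ : ∀ i, Φ (X i) ∈ idealOfVars τ k) {j : ℕ} {p : MvPolynomial σ k}
    (hp : p ∈ idealOfVars σ k ^ j) : Φ p ∈ idealOfVars τ k ^ j := by
  have h1 : (idealOfVars σ k).map Φ ≤ idealOfVars τ k := by
    rw [Ideal.map_le_iff_le_comap, Ideal.span_le]
    rintro _ ⟨i, rfl⟩
    exact hΦ i
  have h2 := Ideal.mem_map_of_mem Φ hp
  rw [Ideal.map_pow] at h2
  exact Ideal.pow_right_mono h1 j h2

theorem sub_mem_of_isHomogeneous {τ : Type*} (Φ A : MvPolynomial σ k →ₐ[k] MvPolynomial τ k)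
    (hΦ : ∀ i, Φ (X i) ∈ idealOfVars τ k) (hA : ∀ i, A (X i) ∈ idealOfVars τ k)
    (hΦA : ∀ i, Φ (X i) - A (X i) ∈ idealOfVars τ k ^ 2) {d : ℕ} {p : MvPolynomial σ k}
    (hp : p.IsHomogeneous d) : Φ p - A p ∈ idealOfVars τ k ^ (d + 1) := by
  have key : ∀ s : σ →₀ ℕ, Φ (monomial s 1) - A (monomial s 1) ∈
      idealOfVars τ k ^ (s.degree + 1) := by
    have hmem : ∀ s : σ →₀ ℕ, (monomial s 1 : MvPolynomial σ k) ∈ idealOfVars σ k ^ s.degree :=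
      fun s ↦ (isHomogeneous_monomial 1 rfl).mem_pow_idealOfVars
    intro s
    induction s using Finsupp.induction_linear with
    | zero => simp
    | add s t hs ht =>
      have e : (monomial (s + t) 1 : MvPolynomial σ k) = monomial s 1 * monomial t 1 := by
        simp [monomial_mul]
      have : Φ (monomial (s + t) 1) - A (monomial (s + t) 1) =
          Φ (monomial s 1) * (Φ (monomial t 1) - A (monomial t 1)) +
          (Φ (monomial s 1) - A (monomial s 1)) * A (monomial t 1) := by
        rw [e, map_mul, map_mul]; ring
      rw [this, map_add]
      refine add_mem ?_ ?_
      · rw [add_assoc, pow_add]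
        exact Ideal.mul_mem_mul (map_pow_idealOfVars_le Φ hΦ (hmem s)) ht
      · rw [add_right_comm, pow_add _ (s.degree + 1)]
        exact Ideal.mul_mem_mul hs (map_pow_idealOfVars_le A hA (hmem t))
    | single i n =>
      induction n with
      | zero => simp
      | succ n ih =>
        have e : (monomial (Finsupp.single i (n + 1)) 1 : MvPolynomial σ k) =
            monomial (Finsupp.single i n) 1 * X i := by
          simp [X, monomial_mul]
        have : Φ (monomial (Finsupp.single i (n + 1)) 1) -
            A (monomial (Finsupp.single i (n + 1)) 1) =
            Φ (monomial (Finsupp.single i n) 1) * (Φ (X i) - A (X i)) +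
            (Φ (monomial (Finsupp.single i n) 1) - A (monomial (Finsupp.single i n) 1))
              * A (X i) := by
          rw [e, map_mul, map_mul]; ring
        rw [this]
        have hm := map_pow_idealOfVars_le Φ hΦ (hmem (Finsupp.single i n))
        simp only [Finsupp.degree_single] at ih hm ⊢
        refine add_mem ?_ ?_
        · rw [show n + 1 + 1 = n + 2 by ring, pow_add]
          exact Ideal.mul_mem_mul hm (hΦA i)
        · rw [pow_succ _ (n + 1)]
          exact Ideal.mul_mem_mul ih (hA i)
  rw [p.as_sum, map_sum, map_sum, ← Finset.sum_sub_distrib]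
  refine sum_mem fun s hs ↦ ?_
  have hsd : s.degree = d := by
    by_contra h
    exact mem_support_iff.1 hs (hp.coeff_eq_zero h)
  have e : (monomial s (coeff s p) : MvPolynomial σ k) = C (coeff s p) * monomial s 1 := by
    simp [C_mul_monomial]
  rw [e, map_mul, map_mul, ← algebraMap_eq, Φ.commutes, A.commutes, ← mul_sub, ← hsd]
  exact Ideal.mul_mem_left _ _ (key s)

theorem _root_.RingHom.injective_of_surjective_of_isNoetherianRing {R : Type*} [CommRing R]
    [IsNoetherianRing R] (f : R →+* R) (hf : Function.Surjective f) : Function.Injective f := by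
  obtain ⟨n, hn⟩ := monotone_stabilizes_iff_noetherian.2 (inferInstanceAs (IsNoetherian R R))
    ⟨fun n ↦ RingHom.ker (f ^ n), monotone_nat_of_le_succ fun n x hx ↦ by
      rw [RingHom.mem_ker] at hx ⊢
      rw [pow_succ', RingHom.mul_def, RingHom.comp_apply, hx, map_zero]⟩
  rw [injective_iff_map_eq_zero]
  intro a ha
  have hsurj : Function.Surjective (f ^ n : R →+* R) := by
    rw [RingHom.coe_pow]; exact hf.iterate n
  obtain ⟨b, rfl⟩ := hsurj a
  have hb : b ∈ RingHom.ker (f ^ (n + 1)) := by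
    rw [RingHom.mem_ker, pow_succ', RingHom.mul_def, RingHom.comp_apply, ha]
  have := hn (n + 1) (by omega)
  simp only [OrderHom.coe_mk] at this
  rw [← this] at hb
  exact hb

end MvPolynomial

/-- The ring homomorphism `ψ : k[y] → L` exhibits `L` as the local ring at the origin of the
hypersurface `h = 0`. -/
structure IsLocalRingOfHypersurface {σ k L : Type*} [Field k] [CommRing L]
    (ψ : MvPolynomial σ k →+* L) (h : MvPolynomial σ k) : Prop where
  isUnit_iff : ∀ s, IsUnit (ψ s) ↔ constantCoeff s ≠ 0
  exists_mul_eq : ∀ r, ∃ a s, constantCoeff s ≠ 0 ∧ r * ψ s = ψ a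
  eq_zero_iff : ∀ a, ψ a = 0 ↔ ∃ s, constantCoeff s ≠ 0 ∧ h ∣ s * a

namespace IsLocalRingOfHypersurface

variable {σ k L : Type*} [Field k] [CommRing L]
  {ψ ψ' : MvPolynomial σ k →+* L} {h h' : MvPolynomial σ k}

theorem map_self (H : IsLocalRingOfHypersurface ψ h) : ψ h = 0 :=
  (H.eq_zero_iff h).2 ⟨1, by simp⟩

theorem map_idealOfVars_le (H : IsLocalRingOfHypersurface ψ h)
    (H' : IsLocalRingOfHypersurface ψ' h') :
    (idealOfVars σ k).map ψ ≤ (idealOfVars σ k).map ψ' := by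
  rw [Ideal.map_le_iff_le_comap]
  intro y hy
  rw [mem_idealOfVars_iff] at hy
  obtain ⟨a, s, hs, e⟩ := H'.exists_mul_eq (ψ y)
  obtain ⟨u, hu⟩ := (H'.isUnit_iff s).2 hs
  have ha : a ∈ idealOfVars σ k := by
    rw [mem_idealOfVars_iff]
    by_contra ha
    rw [← ne_eq, ← H'.isUnit_iff, ← e] at ha
    exact (H.isUnit_iff y).1 (isUnit_of_mul_isUnit_left ha) hy
  have : ψ y = ψ' a * ↑u⁻¹ := by rw [← e, ← hu, mul_assoc, Units.mul_inv, mul_one]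
  rw [Ideal.mem_comap, this]
  exact Ideal.mul_mem_right _ _ (Ideal.mem_map_of_mem _ ha)

theorem map_idealOfVars_eq (H : IsLocalRingOfHypersurface ψ h)
    (H' : IsLocalRingOfHypersurface ψ' h') :
    (idealOfVars σ k).map ψ = (idealOfVars σ k).map ψ' :=
  le_antisymm (H.map_idealOfVars_le H') (H'.map_idealOfVars_le H)

theorem mem_sup_of_mem_map (H : IsLocalRingOfHypersurface ψ h) {j : ℕ} {a : MvPolynomial σ k}
    (ha : ψ a ∈ (idealOfVars σ k).map ψ ^ j) : a ∈ Ideal.span {h} ⊔ idealOfVars σ k ^ j := by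
  rw [← Ideal.map_pow] at ha
  have key : ∀ x ∈ (idealOfVars σ k ^ j).map ψ,
      ∃ s, constantCoeff s ≠ 0 ∧ ∃ b ∈ idealOfVars σ k ^ j, x * ψ s = ψ b := by
    intro x hx
    refine Submodule.span_induction ?_ ?_ ?_ ?_ hx
    · rintro _ ⟨b, hb, rfl⟩
      exact ⟨1, by simp, b, hb, by simp⟩
    · exact ⟨1, by simp, 0, zero_mem _, by simp⟩
    · rintro x y - - ⟨s, hs, b, hb, e⟩ ⟨t, ht, c, hc, e'⟩
      refine ⟨s * t, by simp [hs, ht], b * t + c * s,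
        add_mem (Ideal.mul_mem_right _ _ hb) (Ideal.mul_mem_right _ _ hc), ?_⟩
      simp only [map_mul, map_add, ← e, ← e']; ring
    · rintro r x - ⟨s, hs, b, hb, e⟩
      obtain ⟨a, t, ht, e'⟩ := H.exists_mul_eq r
      refine ⟨s * t, by simp [hs, ht], a * b, Ideal.mul_mem_left _ _ hb, ?_⟩
      simp only [map_mul, ← e, ← e', smul_eq_mul]; ring
  obtain ⟨s, hs, b, hb, e⟩ := key _ ha
  obtain ⟨t, ht, hd⟩ := (H.eq_zero_iff (a * s - b)).1 (by rw [map_sub, map_mul, e, sub_self])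
  obtain ⟨v, hv⟩ := exists_mul_sub_one_mem_pow (u := s * t) (by simp [hs, ht]) j
  have : a = v * (t * (a * s - b)) + (v * t * b - (v * (s * t) - 1) * a) := by ring
  rw [this]
  refine Submodule.add_mem_sup (Ideal.mul_mem_left _ _ (Ideal.mem_span_singleton.2 hd)) ?_
  exact sub_mem (Ideal.mul_mem_left _ _ hb) (Ideal.mul_mem_right _ _ hv)

theorem exists_sub_mem (H : IsLocalRingOfHypersurface ψ h) (r : L) (j : ℕ) :
    ∃ a, ψ a - r ∈ (idealOfVars σ k).map ψ ^ j := by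
  obtain ⟨a, s, hs, e⟩ := H.exists_mul_eq r
  obtain ⟨v, hv⟩ := exists_mul_sub_one_mem_pow hs j
  refine ⟨v * a, ?_⟩
  have : ψ (v * a) - r = r * ψ (v * s - 1) := by
    simp only [map_mul, map_sub, map_one, ← e]; ring
  rw [this, ← Ideal.map_pow]
  exact Ideal.mul_mem_left _ _ (Ideal.mem_map_of_mem _ hv)

theorem exists_algHom (H : IsLocalRingOfHypersurface ψ h)
    (H' : IsLocalRingOfHypersurface ψ' h') (hC : ∀ c, ψ (C c) = ψ' (C c)) (j : ℕ) :
    ∃ Φ : MvPolynomial σ k →ₐ[k] MvPolynomial σ k, (∀ i, Φ (X i) ∈ idealOfVars σ k) ∧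
      ∀ a, ψ' (Φ a) - ψ a ∈ (idealOfVars σ k).map ψ ^ (j + 1) := by
  choose p hp using fun i : σ ↦ H'.exists_sub_mem (ψ (X i)) (j + 1)
  rw [← H.map_idealOfVars_eq H'] at hp
  refine ⟨aeval p, fun i ↦ ?_, fun a ↦ ?_⟩
  · have h1 : p i ∈ Ideal.span {h'} ⊔ idealOfVars σ k ^ 1 := by
      apply H'.mem_sup_of_mem_map
      rw [← H.map_idealOfVars_eq H', pow_one, ← sub_add_cancel (ψ' (p i)) (ψ (X i))]
      refine add_mem (Ideal.pow_le_self (by omega) (hp i)) (Ideal.mem_map_of_mem _ ?_)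
      exact Ideal.subset_span ⟨i, rfl⟩
    have h2 : Ideal.span {h'} ≤ idealOfVars σ k := by
      rw [Ideal.span_singleton_le_iff_mem, mem_idealOfVars_iff]
      by_contra h3
      have h4 := (H'.isUnit_iff h').2 h3
      rw [H'.map_self, isUnit_zero_iff] at h4
      have h5 : IsUnit (ψ' 0) := by rw [map_zero, h4]; exact isUnit_one
      rw [H'.isUnit_iff] at h5
      simp at h5
    rw [pow_one, sup_eq_right.2 h2] at h1
    simpa using h1
  · rw [← Ideal.Quotient.eq]
    have : ((Ideal.Quotient.mk ((idealOfVars σ k).map ψ ^ (j + 1))).comp ψ').comp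
        (aeval p : MvPolynomial σ k →ₐ[k] MvPolynomial σ k).toRingHom =
        (Ideal.Quotient.mk ((idealOfVars σ k).map ψ ^ (j + 1))).comp ψ := by
      apply MvPolynomial.ringHom_ext
      · intro c
        simp [algHom_C, hC]
      · intro i
        simpa [Ideal.Quotient.eq] using hp i
    exact RingHom.congr_fun this a

end IsLocalRingOfHypersurface

theorem mul_eq_one_of_bind₁ {σ k : Type*} [Fintype σ] [DecidableEq σ] [Field k]
    {A B : Matrix σ σ k} (h : ∀ i, bind₁ B.toMvPolynomial (A.toMvPolynomial i) = X i) :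
    A * B = 1 := by
  apply Matrix.mulVec_injective
  funext c
  ext i
  rw [← Matrix.toMvPolynomial_eval_eq_apply, Matrix.toMvPolynomial_mul, h]
  simp

/-- The linear coordinate change attached to a pair of inverse matrices. -/
def linearChange {σ k : Type*} [Fintype σ] [DecidableEq σ] [Field k]
    (A B : Matrix σ σ k) (hAB : A * B = 1) (hBA : B * A = 1) :
    MvPolynomial σ k ≃ₐ[k] MvPolynomial σ k :=
  AlgEquiv.ofAlgHom (bind₁ A.toMvPolynomial) (bind₁ B.toMvPolynomial)
    (by ext1 i; simp [← Matrix.toMvPolynomial_mul, hBA, Matrix.toMvPolynomial_one])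
    (by ext1 i; simp [← Matrix.toMvPolynomial_mul, hAB, Matrix.toMvPolynomial_one])

/-- An automorphism of the polynomial ring which is linear in the coordinates. -/
structure IsLinearChange {σ k : Type*} [Field k]
    (E : MvPolynomial σ k ≃ₐ[k] MvPolynomial σ k) : Prop where
  hom : ∀ i, (E (X i)).IsHomogeneous 1
  inv : ∀ i, (E.symm (X i)).IsHomogeneous 1

namespace IsLinearChange

variable {σ k : Type*} [Field k] {E F : MvPolynomial σ k ≃ₐ[k] MvPolynomial σ k}

theorem symm (hE : IsLinearChange E) : IsLinearChange E.symm := ⟨hE.inv, hE.hom⟩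

theorem isHomogeneous (hE : IsLinearChange E) {p : MvPolynomial σ k} {d : ℕ}
    (hp : p.IsHomogeneous d) : (E p).IsHomogeneous d := by
  have : E p = aeval (fun i ↦ E (X i)) p :=
    AlgHom.congr_fun (aeval_unique (E : MvPolynomial σ k →ₐ[k] MvPolynomial σ k)) p
  rw [this, ← one_mul d]
  exact hp.aeval _ hE.hom

theorem trans (hE : IsLinearChange E) (hF : IsLinearChange F) : IsLinearChange (E.trans F) :=
  ⟨fun i ↦ hF.isHomogeneous (hE.hom i), fun i ↦ hE.symm.isHomogeneous (hF.inv i)⟩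

end IsLinearChange

theorem isLinearChange_linearChange {σ k : Type*} [Fintype σ] [DecidableEq σ] [Field k]
    (A B : Matrix σ σ k) (hAB : A * B = 1) (hBA : B * A = 1) :
    IsLinearChange (linearChange A B hAB hBA) :=
  ⟨fun i ↦ by simpa [linearChange] using A.toMvPolynomial_isHomogeneous i,
    fun i ↦ by simpa [linearChange] using B.toMvPolynomial_isHomogeneous i⟩

theorem exists_isLinearChange_X_eq {σ k : Type*} [DecidableEq σ] [Field k]
    {l : MvPolynomial σ k} (hl : l.IsHomogeneous 1) (i : σ)
    (hi : coeff (Finsupp.single i 1) l ≠ 0) :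
    ∃ E : MvPolynomial σ k ≃ₐ[k] MvPolynomial σ k, IsLinearChange E ∧ E (X i) = l := by
  set a := coeff (Finsupp.single i 1) l with ha
  set m := l - C a * X i with hm
  have hmh : m.IsHomogeneous 1 := hl.sub ((isHomogeneous_X k i).C_mul a)
  have hmc : coeff (Finsupp.single i 1) m = 0 := by simp [hm, ← ha, coeff_C_mul]
  set F : σ → MvPolynomial σ k := fun j ↦ if j = i then l else X j with hF
  set G : σ → MvPolynomial σ k := fun j ↦ if j = i then C a⁻¹ * (X i - m) else X j with hG
  have hinv : ∀ T : σ → MvPolynomial σ k, (∀ j, j ≠ i → T j = X j) → bind₁ T m = m := by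
    intro T hT
    rw [← aeval_eq_bind₁]
    conv_rhs => rw [← aeval_X_left_apply m]
    refine eval₂Hom_congr' rfl (fun j hj _ ↦ hT j ?_) rfl
    rintro rfl
    obtain ⟨s, hs, hjs⟩ := (mem_vars_iff_mem_support j).1 hj
    have hdeg := hmh (mem_support_iff.1 hs)
    have hs1 : s.degree = 1 := by rwa [Finsupp.degree_eq_weight_one]
    obtain ⟨t, rfl⟩ := (Finsupp.sum_eq_one_iff s).1 hs1
    have : j = t := by simpa using hjs
    subst this
    exact mem_support_iff.1 hs hmc
  have hl' : l = C a * X i + m := by rw [hm]; ring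
  have hCa : (C a : MvPolynomial σ k) * C a⁻¹ = 1 := by rw [← C_mul, mul_inv_cancel₀ hi, C_1]
  refine ⟨AlgEquiv.ofAlgHom (bind₁ F) (bind₁ G) ?_ ?_, ⟨fun j ↦ ?_, fun j ↦ ?_⟩, ?_⟩
  · ext1 j
    by_cases h : j = i
    · subst h
      have := hinv F fun t ht ↦ by simp [hF, ht]
      simp only [AlgHom.comp_apply, bind₁_X_right, hG, if_true, map_mul, map_sub, this,
        algHom_C, algebraMap_eq, AlgHom.id_apply]
      simp only [hF, if_true]
      rw [hl', add_sub_cancel_right, ← mul_assoc, mul_comm (C _), hCa, one_mul]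
    · simp [hF, hG, h]
  · ext1 j
    by_cases h : j = i
    · subst h
      have := hinv G fun t ht ↦ by simp [hG, ht]
      simp only [AlgHom.comp_apply, bind₁_X_right, hF, if_true, AlgHom.id_apply]
      rw [hl', map_add, this, map_mul, algHom_C, algebraMap_eq, bind₁_X_right]
      simp only [hG, if_true]
      rw [← mul_assoc, hCa]; ring
    · simp [hF, hG, h]
  · by_cases h : j = i
    · simpa [hF, h] using hl
    · simpa [hF, h] using isHomogeneous_X k j
  · by_cases h : j = i
    · simpa [hG, h] using ((isHomogeneous_X k i).sub hmh).C_mul a⁻¹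
    · simpa [hG, h] using isHomogeneous_X k j
  · simp [hF]

theorem isLinearChange_renameEquiv {σ k : Type*} [Field k] (e : σ ≃ σ) :
    IsLinearChange (renameEquiv k e) :=
  ⟨fun i ↦ by simpa using isHomogeneous_X k _, fun i ↦ by simpa using isHomogeneous_X k _⟩

theorem exists_isLinearChange_of_isHomogeneous_one {σ k : Type*} [Field k]
    {l m : MvPolynomial σ k} (hl : l.IsHomogeneous 1) (hm : m.IsHomogeneous 1)
    (hl0 : l ≠ 0) (hm0 : m ≠ 0) :
    ∃ E : MvPolynomial σ k ≃ₐ[k] MvPolynomial σ k, IsLinearChange E ∧ E l = m := by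
  classical
  have key : ∀ {p : MvPolynomial σ k}, p.IsHomogeneous 1 → p ≠ 0 →
      ∃ i, coeff (Finsupp.single i 1) p ≠ 0 := by
    intro p hp hp0
    obtain ⟨s, hs⟩ := ne_zero_iff.1 hp0
    have hs1 : s.degree = 1 := by
      have := hp hs
      rwa [Finsupp.degree_eq_weight_one]
    obtain ⟨t, rfl⟩ := (Finsupp.sum_eq_one_iff s).1 hs1
    exact ⟨t, hs⟩
  obtain ⟨i, hi⟩ := key hl hl0
  obtain ⟨j, hj⟩ := key hm hm0
  obtain ⟨E, hE, e⟩ := exists_isLinearChange_X_eq hl i hi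
  obtain ⟨F, hF, e'⟩ := exists_isLinearChange_X_eq hm j hj
  refine ⟨(E.symm.trans (renameEquiv k (Equiv.swap i j))).trans F,
    (hE.symm.trans (isLinearChange_renameEquiv _)).trans hF, ?_⟩
  simp [← e, e']

theorem exists_matrix_sub_mem {σ k : Type*} [Fintype σ] [DecidableEq σ] [Field k]
    (p : σ → MvPolynomial σ k) (hp : ∀ i, p i ∈ idealOfVars σ k) :
    ∃ A : Matrix σ σ k, ∀ i, p i - A.toMvPolynomial i ∈ idealOfVars σ k ^ 2 := by
  refine ⟨fun i j ↦ coeff (Finsupp.single j 1) (p i), fun i ↦ ?_⟩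
  rw [mem_pow_idealOfVars_iff']
  intro s hs
  rw [coeff_sub, sub_eq_zero]
  have hA := Matrix.toMvPolynomial_isHomogeneous
    (fun i j ↦ coeff (Finsupp.single j 1) (p i) : Matrix σ σ k) i
  by_cases h1 : s.degree = 1
  · obtain ⟨t, rfl⟩ := (Finsupp.sum_eq_one_iff s).1 h1
    simp [Matrix.toMvPolynomial, coeff_sum, coeff_monomial, Finsupp.single_left_inj]
  · have h0 : s = 0 := (Finsupp.degree_eq_zero_iff s).1 (by omega)
    rw [hA.coeff_eq_zero h1, h0]
    exact (mem_idealOfVars_iff _).1 (hp i)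

namespace IsLocalRingOfHypersurface

variable {σ k L : Type*} [Fintype σ] [Field k] [CommRing L]
  {ψ ψ' : MvPolynomial σ k →+* L} {f r : MvPolynomial σ k} {e : ℕ}

theorem mem_pow_idealOfVars (H : IsLocalRingOfHypersurface ψ f)
    (H' : IsLocalRingOfHypersurface ψ' r) (hC : ∀ c, ψ (C c) = ψ' (C c))
    (hf : f.IsHomogeneous e) : r ∈ idealOfVars σ k ^ e := by
  obtain ⟨Φ, hΦ, hΦψ⟩ := H.exists_algHom H' hC e
  obtain ⟨Φ', hΦ', hΦψ'⟩ := H'.exists_algHom H (fun c ↦ (hC c).symm) e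
  rw [← H.map_idealOfVars_eq H'] at hΦψ'
  have hle : Ideal.span {f} ⊔ idealOfVars σ k ^ (e + 1) ≤ idealOfVars σ k ^ e :=
    sup_le ((Ideal.span_singleton_le_iff_mem _).2 hf.mem_pow_idealOfVars)
      (Ideal.pow_le_pow_right e.le_succ)
  have hcomp : ∀ a, Φ' (Φ a) - a ∈ idealOfVars σ k ^ e := fun a ↦ by
    refine hle (H.mem_sup_of_mem_map ?_)
    rw [map_sub, ← sub_add_sub_cancel _ (ψ' (Φ a))]
    exact add_mem (hΦψ' _) (hΦψ _)
  have hr : Φ' r ∈ idealOfVars σ k ^ e := by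
    refine hle (H.mem_sup_of_mem_map ?_)
    simpa [H'.map_self] using hΦψ' r
  let T := Ideal.quotientMap (idealOfVars σ k ^ e) Φ'.toRingHom (I := idealOfVars σ k ^ e)
    fun a ha ↦ map_pow_idealOfVars_le Φ' hΦ' ha
  have hT : Function.Surjective T := by
    intro x
    obtain ⟨a, rfl⟩ := Ideal.Quotient.mk_surjective x
    exact ⟨Ideal.Quotient.mk _ (Φ a), Ideal.Quotient.eq.2 (hcomp a)⟩
  have hTi := RingHom.injective_of_surjective_of_isNoetherianRing T hT
  rw [← Ideal.Quotient.eq_zero_iff_mem]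
  apply hTi
  rw [map_zero]
  exact Ideal.Quotient.eq_zero_iff_mem.2 hr

theorem exists_isLinearChange (H : IsLocalRingOfHypersurface ψ f)
    (H' : IsLocalRingOfHypersurface ψ' r) (hC : ∀ c, ψ (C c) = ψ' (C c))
    (hf0 : f ≠ 0) (hr0 : r ≠ 0) (hf : f.IsHomogeneous e) (he : 1 ≤ e) (hr : r.totalDegree ≤ e) :
    r.IsHomogeneous e ∧ ∃ E : MvPolynomial σ k ≃ₐ[k] MvPolynomial σ k, IsLinearChange E ∧
      ∃ c ≠ 0, E f = C c * r := by
  classical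
  have hrh := isHomogeneous_of_mem_pow (H.mem_pow_idealOfVars H' hC hf) hr
  refine ⟨hrh, ?_⟩
  obtain rfl | he2 := he.eq_or_lt
  · obtain ⟨E, hE, h⟩ := exists_isLinearChange_of_isHomogeneous_one hf hrh hf0 hr0
    exact ⟨E, hE, 1, one_ne_zero, by simpa using h⟩
  obtain ⟨Φ, hΦ, hΦψ⟩ := H.exists_algHom H' hC e
  obtain ⟨Φ', hΦ', hΦψ'⟩ := H'.exists_algHom H (fun c ↦ (hC c).symm) e
  rw [← H.map_idealOfVars_eq H'] at hΦψ'
  obtain ⟨A, hA⟩ := exists_matrix_sub_mem _ hΦ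
  obtain ⟨A', hA'⟩ := exists_matrix_sub_mem _ hΦ'
  have hlin : ∀ (B : Matrix σ σ k) i, bind₁ B.toMvPolynomial (X i) ∈ idealOfVars σ k := fun B i ↦ by
    simpa using (B.toMvPolynomial_isHomogeneous i).mem_pow_idealOfVars
  have hle : Ideal.span {f} ⊔ idealOfVars σ k ^ (e + 1) ≤ idealOfVars σ k ^ 2 :=
    sup_le ((Ideal.span_singleton_le_iff_mem _).2
      (Ideal.pow_le_pow_right he2 hf.mem_pow_idealOfVars)) (Ideal.pow_le_pow_right (by omega))
  have hAA' : A * A' = 1 := by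
    apply mul_eq_one_of_bind₁
    intro i
    have h1 : Φ' (Φ (X i)) - X i ∈ idealOfVars σ k ^ 2 := by
      refine hle (H.mem_sup_of_mem_map ?_)
      rw [map_sub, ← sub_add_sub_cancel _ (ψ' (Φ (X i)))]
      exact add_mem (hΦψ' _) (hΦψ _)
    have h2 := map_pow_idealOfVars_le Φ' hΦ' (hA i)
    have h3 := sub_mem_of_isHomogeneous Φ' (bind₁ A'.toMvPolynomial) hΦ' (hlin A')
      (by simpa using hA') (A.toMvPolynomial_isHomogeneous i)
    rw [map_sub] at h2
    rw [← sub_eq_zero]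
    refine IsHomogeneous.eq_zero_of_mem_pow (d := 1) (IsHomogeneous.sub ?_ (isHomogeneous_X k i)) ?_
    · rw [← one_mul 1]
      exact (A.toMvPolynomial_isHomogeneous i).aeval _ A'.toMvPolynomial_isHomogeneous
    · convert sub_mem (sub_mem h1 h2) h3 using 1
      ring
  have hA'A := mul_eq_one_comm.1 hAA'
  refine ⟨linearChange A A' hAA' hA'A, isLinearChange_linearChange _ _ _ _, ?_⟩
  have h1 : Φ f ∈ Ideal.span {r} ⊔ idealOfVars σ k ^ (e + 1) := by
    apply H'.mem_sup_of_mem_map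
    rw [← H.map_idealOfVars_eq H']
    simpa [H.map_self] using hΦψ f
  obtain ⟨y, hy, z, hz, hyz⟩ := Submodule.mem_sup.1 h1
  obtain ⟨b, rfl⟩ := Ideal.mem_span_singleton'.1 hy
  have h2 := sub_mem_of_isHomogeneous Φ (bind₁ A.toMvPolynomial) hΦ (hlin A)
      (by simpa using hA) hf
  have hEf := (isLinearChange_linearChange A A' hAA' hA'A).isHomogeneous hf
  have h3 : linearChange A A' hAA' hA'A f = C (constantCoeff b) * r := by
    rw [← sub_eq_zero]
    refine IsHomogeneous.eq_zero_of_mem_pow (d := e) (hEf.sub (hrh.C_mul _)) ?_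
    have h4 : (b - C (constantCoeff b)) * r ∈ idealOfVars σ k ^ (e + 1) := by
      rw [pow_succ']
      exact Ideal.mul_mem_mul ((mem_idealOfVars_iff _).2 (by simp)) hrh.mem_pow_idealOfVars
    have : linearChange A A' hAA' hA'A f = bind₁ A.toMvPolynomial f := rfl
    rw [this]
    convert sub_mem (add_mem h4 hz) h2 using 1
    rw [← hyz]; ring
  refine ⟨_, ?_, h3⟩
  intro h0
  rw [h0, C_0, zero_mul] at h3
  exact hf0 ((map_eq_zero_iff _ (AlgEquiv.injective _)).1 h3)

end IsLocalRingOfHypersurface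

theorem AlgebraicGeometry.IsAffineOpen.mem_radical_of_basicOpen_le {P : Scheme} {U : P.Opens}
    (hU : IsAffineOpen U) {a b : Γ(P, U)} (h : P.basicOpen a ≤ P.basicOpen b) :
    a ∈ (Ideal.span {b}).radical := by
  rw [← PrimeSpectrum.basicOpen_le_basicOpen_iff, ← hU.fromSpec_preimage_basicOpen,
    ← hU.fromSpec_preimage_basicOpen]
  exact fun x hx ↦ h hx

/-- Sections over `U ⊆ P` pulled back to the stalk of `H` at a point `p` lying over `U`. -/
def toStalk {H P : Scheme} (ι : H ⟶ P) (p : H) (U : P.Opens) (hp : ι p ∈ U) :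
    Γ(P, U) →+* H.presheaf.stalk p :=
  (P.presheaf.germ U (ι p) hp ≫ ι.stalkMap p).hom

section toStalk

variable {H P : Scheme} (ι : H ⟶ P) (p : H) (U : P.Opens) (hp : ι p ∈ U)

theorem isUnit_toStalk_iff (s : Γ(P, U)) : IsUnit (toStalk ι p U hp s) ↔ ι p ∈ P.basicOpen s := by
  rw [P.mem_basicOpen s _ hp, toStalk, CommRingCat.hom_comp, RingHom.comp_apply, isUnit_map_iff]

theorem toStalk_eq_germ (s : Γ(P, U)) :
    toStalk ι p U hp s = H.presheaf.germ (ι ⁻¹ᵁ U) p hp (ι.app U s) := by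
  rw [toStalk, Scheme.Hom.germ_stalkMap]
  rfl

theorem exists_toStalk_mul_eq [IsClosedImmersion ι] (hU : IsAffineOpen U)
    (r : H.presheaf.stalk p) :
    ∃ a s, IsUnit (toStalk ι p U hp s) ∧ r * toStalk ι p U hp s = toStalk ι p U hp a := by
  obtain ⟨t, rfl⟩ := ι.stalkMap_surjective p r
  let : Algebra Γ(P, U) (P.presheaf.stalk (ι p)) := (P.presheaf.germ U (ι p) hp).hom.toAlgebra
  have hloc : IsLocalization.AtPrime (P.presheaf.stalk (ι p))
    (hU.primeIdealOf ⟨ι p, hp⟩).asIdeal := hU.isLocalization_stalk ⟨ι p, hp⟩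
  obtain ⟨⟨a, s⟩, h⟩ := IsLocalization.surj (hU.primeIdealOf ⟨ι p, hp⟩).asIdeal.primeCompl t
  refine ⟨a, s, ?_, ?_⟩
  · exact (IsLocalization.map_units (P.presheaf.stalk (ι p)) s).map (ι.stalkMap p).hom
  · have := congr((ι.stalkMap p).hom $h)
    rw [map_mul] at this
    exact this

theorem toStalk_eq_zero_iff [IsClosedImmersion ι] [IsReduced H] (hU : IsAffineOpen U)
    (F : Γ(P, U)) (hF : ∀ x ∈ U, x ∈ Set.range ι ↔ x ∉ P.basicOpen F) (a : Γ(P, U)) :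
    toStalk ι p U hp a = 0 ↔
      ∃ s, IsUnit (toStalk ι p U hp s) ∧ s * a ∈ (Ideal.span {F}).radical := by
  constructor
  · intro h
    rw [toStalk_eq_germ] at h
    obtain ⟨V, hpV, hVU, _, hV⟩ := H.presheaf.germ_eq (U := ι ⁻¹ᵁ U) (V := ι ⁻¹ᵁ U)
      p hp hp (ι.app U a) 0 (by rw [h, map_zero])
    obtain ⟨W, hW, hWV⟩ := ι.isClosedEmbedding.isInducing.isOpen_iff.1 V.isOpen
    have hpW : ι p ∈ W := by
      have : p ∈ ι ⁻¹' W := by rw [hWV]; exact hpV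
      exact this
    obtain ⟨s, hsW, hps⟩ := hU.exists_basicOpen_le (V := ⟨W, hW⟩) ⟨ι p, hpW⟩ hp
    refine ⟨s, (isUnit_toStalk_iff ι p U hp s).2 hps, hU.mem_radical_of_basicOpen_le ?_⟩
    intro x hx
    by_contra hxF
    have hxU : x ∈ U := P.basicOpen_le _ hx
    obtain ⟨q, rfl⟩ := (hF x hxU).2 hxF
    rw [Scheme.basicOpen_mul] at hx
    have hqV : q ∈ V := by
      have : q ∈ ι ⁻¹' W := hsW hx.1
      rw [hWV] at this
      exact this
    have hu := (isUnit_toStalk_iff ι q U hxU a).2 hx.2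
    rw [toStalk_eq_germ, ← H.presheaf.germ_res_apply hVU q hqV, hV, map_zero,
      map_zero] at hu
    exact not_isUnit_zero hu
  · rintro ⟨s, hs, m, hm⟩
    have hF0 : toStalk ι p U hp F = 0 := by
      have : ι.app U F = 0 := by
        rw [← basicOpen_eq_bot_iff, ← Scheme.preimage_basicOpen, eq_bot_iff]
        intro q hq
        exact absurd hq ((hF (ι q) (P.basicOpen_le F hq)).1 ⟨q, rfl⟩)
      rw [toStalk_eq_germ, this, map_zero]
    obtain ⟨c, hc⟩ := Ideal.mem_span_singleton'.1 hm
    have h1 : toStalk ι p U hp (s * a) ^ m = 0 := by rw [← map_pow, ← hc, map_mul, hF0, mul_zero]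
    have h2 := eq_zero_of_pow_eq_zero h1
    rw [map_mul] at h2
    exact (hs.mul_right_eq_zero).1 h2

end toStalk

section Proj

variable {A : Type} {τ : Type*} [CommRing A] [SetLike τ A] [AddSubgroupClass τ A] (𝒜 : ℕ → τ)
  [GradedRing 𝒜] {f : A} {m : ℕ}

theorem mem_basicOpen_awayToSection_iff (hf : f ∈ 𝒜 m) (j : ℕ) (F : A) (hF : F ∈ 𝒜 (j • m))
    {x : Proj 𝒜} (hx : x ∈ Proj.basicOpen 𝒜 f) :
    x ∈ (Proj 𝒜).basicOpen (Proj.awayToSection 𝒜 f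
      (HomogeneousLocalization.Away.mk 𝒜 hf j F hF)) ↔ F ∉ x.asHomogeneousIdeal := by
  rw [(Proj 𝒜).mem_basicOpen _ x hx]
  have h := congr($(ProjectiveSpectrum.Proj.awayToSection_germ 𝒜 f x hx)
    (HomogeneousLocalization.Away.mk 𝒜 hf j F hF))
  have h' : (Proj 𝒜).presheaf.germ _ x hx (Proj.awayToSection 𝒜 f
      (HomogeneousLocalization.Away.mk 𝒜 hf j F hF)) =
    (AlgebraicGeometry.Proj.stalkIso' 𝒜 x).symm (HomogeneousLocalization.mapId 𝒜
      (Submonoid.powers_le.mpr hx) (HomogeneousLocalization.Away.mk 𝒜 hf j F hF)) := h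
  rw [h']
  refine (isUnit_map_iff (AlgebraicGeometry.Proj.stalkIso' 𝒜 x).symm _).trans ?_
  rw [← HomogeneousLocalization.isUnit_iff_isUnit_val]
  have : x.asHomogeneousIdeal.toIdeal.IsPrime := ProjectiveSpectrum.isPrime x
  have h2 : f ^ j ∈ x.asHomogeneousIdeal.toIdeal.primeCompl :=
    pow_mem (S := x.asHomogeneousIdeal.toIdeal.primeCompl) hx j
  have h3 : (HomogeneousLocalization.mapId 𝒜 (Submonoid.powers_le.mpr hx)
      (HomogeneousLocalization.Away.mk 𝒜 hf j F hF) :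
        HomogeneousLocalization.AtPrime 𝒜 x.asHomogeneousIdeal.toIdeal).val =
      IsLocalization.mk' (Localization.AtPrime x.asHomogeneousIdeal.toIdeal) F ⟨f ^ j, h2⟩ :=
    Localization.mk_eq_mk'_apply _ _
  rw [h3, IsLocalization.AtPrime.isUnit_mk'_iff]
  rfl

theorem fromZeroRingHom_awayToSection (hf : f ∈ 𝒜 m) (hm : 0 < m) :
    CommRingCat.ofHom (HomogeneousLocalization.fromZeroRingHom 𝒜 _) ≫ Proj.awayToSection 𝒜 f =
      (Scheme.ΓSpecIso _).inv ≫ (Proj.toSpecZero 𝒜).appTop ≫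
        (Proj 𝒜).presheaf.map (homOfLE le_top).op := by
  have h : (Proj.basicOpen 𝒜 f).ι ≫ Proj.toSpecZero 𝒜 = Proj.basicOpenToSpec 𝒜 f ≫
      Spec.map (CommRingCat.ofHom (HomogeneousLocalization.fromZeroRingHom 𝒜 _)) := by
    rw [← Proj.awayι_toSpecZero 𝒜 f hf hm, Proj.awayι, ← Proj.basicOpenIsoSpec_hom 𝒜 f hf hm,
      Category.assoc, Iso.hom_inv_id_assoc]
  have h2 := congr($(congrArg Scheme.Hom.appTop h) ≫ (Proj.basicOpen 𝒜 f).topIso.hom)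
  have h3 : (Proj.basicOpenToSpec 𝒜 f).appTop = (Scheme.ΓSpecIso _).hom ≫
      Proj.awayToSection 𝒜 f ≫ (Proj.basicOpen 𝒜 f).topIso.inv := Proj.basicOpenToSpec_app_top 𝒜 f
  have h4 : (Proj.basicOpen 𝒜 f).ι.appTop ≫ (Proj.basicOpen 𝒜 f).topIso.hom =
      (Proj 𝒜).presheaf.map (homOfLE le_top).op := by
    rw [Scheme.Opens.ι_appTop, Scheme.Opens.topIso_hom]
    exact ((Proj 𝒜).presheaf.map_comp _ _).symm
  rw [Scheme.Hom.comp_appTop, Scheme.Hom.comp_appTop, h3, Category.assoc, h4] at h2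
  rw [h2, Category.assoc, Category.assoc, Category.assoc, Iso.inv_hom_id, Category.comp_id,
    Scheme.ΓSpecIso_naturality_assoc, Iso.inv_hom_id_assoc]

end Proj

namespace MvPolynomial

theorem IsHomogeneous.map_mul_pow {σ k Λ : Type*} [CommSemiring k] [CommSemiring Λ]
    {φ ψ : MvPolynomial σ k →+* Λ} {u : Λ} (hC : ∀ c, φ (C c) = ψ (C c))
    (hX : ∀ i, φ (X i) * u = ψ (X i)) {F : MvPolynomial σ k} {j : ℕ} (hF : F.IsHomogeneous j) :
    φ F * u ^ j = ψ F := by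
  conv_lhs => rw [F.as_sum]
  conv_rhs => rw [F.as_sum]
  rw [map_sum, map_sum, Finset.sum_mul]
  refine Finset.sum_congr rfl fun s hs ↦ ?_
  rw [monomial_eq, map_mul, map_mul, hC, Finsupp.prod, map_prod, map_prod, mul_assoc]
  congr 1
  have hj : j = ∑ i ∈ s.support, s i := by
    rw [← hF (mem_support_iff.1 hs)]
    simp [Finsupp.weight_apply, Finsupp.sum]
  rw [hj, ← Finset.prod_pow_eq_pow_sum, ← Finset.prod_mul_distrib]
  exact Finset.prod_congr rfl fun i _ ↦ by rw [map_pow, map_pow, ← hX, mul_pow]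

/-- Units of a local ring among the values of a polynomial at nonunits. -/
theorem isUnit_map_iff_constantCoeff {σ k L : Type*} [Field k] [CommRing L] [IsLocalRing L]
    (φ : MvPolynomial σ k →+* L) (h : ∀ i, ¬ IsUnit (φ (X i))) (s : MvPolynomial σ k) :
    IsUnit (φ s) ↔ constantCoeff s ≠ 0 := by
  have hm : (IsLocalRing.maximalIdeal L).comap φ =
      RingHom.ker (constantCoeff (σ := σ) (R := k)) := by
    symm
    refine Ideal.IsMaximal.eq_of_le
      (RingHom.ker_isMaximal_of_surjective _ fun c ↦ ⟨C c, constantCoeff_C _ c⟩)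
      (Ideal.IsPrime.ne_top inferInstance) ?_
    have hk : RingHom.ker (constantCoeff (σ := σ) (R := k)) = idealOfVars σ k :=
      Ideal.ext fun p ↦ (mem_idealOfVars_iff p).symm
    rw [hk, idealOfVars, Ideal.span_le]
    rintro _ ⟨i, rfl⟩
    exact h i
  have := SetLike.ext_iff.1 hm s
  rw [Ideal.mem_comap, IsLocalRing.mem_maximalIdeal, mem_nonunits_iff, RingHom.mem_ker] at this
  exact not_iff_not.1 (this.trans not_not.symm)

/-- Dehomogenization with respect to the last variable. -/
def dehom (k : Type) [Field k] (n : ℕ) :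
    MvPolynomial (Fin (n + 1)) k →ₐ[k] MvPolynomial (Fin n) k :=
  aeval (Fin.lastCases 1 X)

variable {k : Type} [Field k] {n : ℕ}

@[simp]
theorem dehom_X_last : dehom k n (X (Fin.last n)) = 1 := by simp [dehom]

@[simp]
theorem dehom_X_castSucc (i : Fin n) : dehom k n (X i.castSucc) = X i := by simp [dehom]

theorem dehom_rename (f : MvPolynomial (Fin n) k) : dehom k n (rename Fin.castSucc f) = f := by
  rw [dehom, aeval_rename]
  convert aeval_X_left_apply f
  ext1 i
  simp

end MvPolynomial

section Chart

variable (k : Type) [Field k] (n : ℕ)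

theorem X_mem_grading (i : Fin (n + 1)) : X i ∈ grading k n 1 := isHomogeneous_X k i

/-- The isomorphism from `k[y]` to the degree zero part of `k[x]` localized at the last variable. -/
def chartHom : MvPolynomial (Fin n) k →+*
    HomogeneousLocalization.Away (grading k n) (X (Fin.last n)) :=
  eval₂Hom ((HomogeneousLocalization.fromZeroRingHom (grading k n) _).comp
    (algebraMap k (grading k n 0)))
    fun i ↦ HomogeneousLocalization.Away.mk _ (X_mem_grading k n (Fin.last n)) 1 (X i.castSucc)
      (by simpa using X_mem_grading k n i.castSucc)

variable {k n}

theorem chartHom_C (c : k) : chartHom k n (C c) =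
    HomogeneousLocalization.fromZeroRingHom (grading k n) _ (algebraMap k (grading k n 0) c) := by
  simp [chartHom]

theorem chartHom_X (i : Fin n) : chartHom k n (X i) =
    HomogeneousLocalization.Away.mk _ (X_mem_grading k n (Fin.last n)) 1 (X i.castSucc)
      (by simpa using X_mem_grading k n i.castSucc) := by
  simp [chartHom]

theorem val_chartHom_C (c : k) : (chartHom k n (C c)).val =
    algebraMap (MvPolynomial (Fin (n + 1)) k) (Localization.Away (X (Fin.last n))) (C c) := by
  rw [chartHom_C]
  exact Localization.mk_one_eq_algebraMap _

theorem val_chartHom_X_mul (i : Fin n) : (chartHom k n (X i)).val *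
      algebraMap (MvPolynomial (Fin (n + 1)) k) (Localization.Away (X (Fin.last n)))
        (X (Fin.last n)) =
    algebraMap (MvPolynomial (Fin (n + 1)) k) (Localization.Away (X (Fin.last n)))
        (X i.castSucc) := by
  simp only [chartHom_X, HomogeneousLocalization.Away.val_mk, pow_one]
  rw [Localization.mk_eq_mk'_apply]
  exact IsLocalization.mk'_spec _ _ _

theorem chartHom_dehom {F : MvPolynomial (Fin (n + 1)) k} {j : ℕ}
    (hF : F ∈ grading k n (j • 1)) : chartHom k n (dehom k n F) =
      HomogeneousLocalization.Away.mk _ (X_mem_grading k n (Fin.last n)) j F hF := by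
  apply HomogeneousLocalization.val_injective
  have hj : F.IsHomogeneous j := by simpa using hF
  let ψ : MvPolynomial (Fin (n + 1)) k →+*
    Localization.Away (X (Fin.last n) : MvPolynomial (Fin (n + 1)) k) := algebraMap _ _
  let φ : MvPolynomial (Fin (n + 1)) k →+*
      Localization.Away (X (Fin.last n) : MvPolynomial (Fin (n + 1)) k) :=
    (algebraMap (HomogeneousLocalization.Away (grading k n) (X (Fin.last n))) _).comp
      ((chartHom k n).comp (dehom k n : _ →+* _))
  have key : φ F * ψ (X (Fin.last n)) ^ j = ψ F := by
    refine hj.map_mul_pow ?_ ?_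
    · intro c
      simpa [φ, ψ] using val_chartHom_C c
    · intro i
      induction i using Fin.lastCases with
      | last => simp [φ]
      | cast i =>
        simpa [φ, ψ] using val_chartHom_X_mul i
  rw [HomogeneousLocalization.Away.val_mk, Localization.mk_eq_mk'_apply,
    IsLocalization.eq_mk'_iff_mul_eq]
  simpa [φ, ψ] using key

theorem _root_.MvPolynomial.IsHomogeneous.eq_of_dehom_eq {F G : MvPolynomial (Fin (n + 1)) k}
    {j : ℕ} (hF : F.IsHomogeneous j) (hG : G.IsHomogeneous j) (h : dehom k n F = dehom k n G) :
    F = G := by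
  have h1 := congrArg (chartHom k n) h
  rw [chartHom_dehom (j := j) (by simpa using hF),
    chartHom_dehom (j := j) (by simpa using hG)] at h1
  replace h1 := congrArg HomogeneousLocalization.val h1
  rw [HomogeneousLocalization.Away.val_mk, HomogeneousLocalization.Away.val_mk,
    Localization.mk_eq_mk_iff, Localization.r_iff_exists] at h1
  obtain ⟨c, hc⟩ := h1
  have hX : (X (Fin.last n) : MvPolynomial (Fin (n + 1)) k) ≠ 0 := X_ne_zero _
  have hc0 : (c : MvPolynomial (Fin (n + 1)) k) ≠ 0 := by
    obtain ⟨m, hm⟩ := c.2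
    rw [← hm]
    exact pow_ne_zero _ hX
  exact mul_left_cancel₀ (pow_ne_zero j hX) (mul_left_cancel₀ hc0 hc)

theorem chartHom_bijective : Function.Bijective (chartHom k n) := by
  constructor
  · let θ : Localization.Away (X (Fin.last n) : MvPolynomial (Fin (n + 1)) k) →+*
        MvPolynomial (Fin n) k :=
      IsLocalization.Away.lift (X (Fin.last n)) 
        (g := (dehom k n : MvPolynomial (Fin (n + 1)) k →+* MvPolynomial (Fin n) k)) (by simp)
    let α : MvPolynomial (Fin (n + 1)) k →+*
      Localization.Away (X (Fin.last n) : MvPolynomial (Fin (n + 1)) k) := algebraMap _ _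
    have hθ (F) : θ (α F) = dehom k n F := IsLocalization.Away.lift_eq _ _ F
    let ψ : HomogeneousLocalization.Away (grading k n) (X (Fin.last n)) →+*
      Localization.Away (X (Fin.last n) : MvPolynomial (Fin (n + 1)) k) := algebraMap _ _
    have h : (θ.comp ψ).comp (chartHom k n) = RingHom.id _ := by
      apply ringHom_ext
      · intro c
        have h1 : ψ (chartHom k n (C c)) = α (C c) := val_chartHom_C c
        simp [h1, hθ]
      · intro i
        have h1 : ψ (chartHom k n (X i)) * α (X (Fin.last n)) = α (X i.castSucc) :=
          val_chartHom_X_mul i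
        have h2 := congrArg θ h1
        rw [map_mul, hθ, hθ, dehom_X_last, mul_one, dehom_X_castSucc] at h2
        exact h2
    exact Function.LeftInverse.injective (g := θ.comp ψ) (RingHom.congr_fun h)
  · intro y
    obtain ⟨j, F, hF, rfl⟩ := HomogeneousLocalization.Away.mk_surjective (grading k n)
      (X_mem_grading k n (Fin.last n)) y
    exact ⟨_, chartHom_dehom hF⟩

end Chart

section Scalars

variable {k : Type} [Field k] {n : ℕ} {H : Scheme}

/-- The scalars in the stalk of a `k`-scheme. -/
def scalarToStalk (s : H ⟶ SpecK k) (p : H) : k →+* H.presheaf.stalk p :=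
  ((Scheme.ΓSpecIso _).inv ≫ s.appTop ≫ H.presheaf.germ ⊤ p trivial).hom

theorem toStalk_awayToSection_fromZeroRingHom (ι : H ⟶ ProjSpace k n) (p : H)
    {f : MvPolynomial (Fin (n + 1)) k} {m : ℕ} (hf : f ∈ grading k n m) (hm : 0 < m)
    (hp : ι p ∈ Proj.basicOpen (grading k n) f) (c : k) :
    toStalk ι p _ hp (Proj.awayToSection (grading k n) f
      (HomogeneousLocalization.fromZeroRingHom _ _ (algebraMap k (grading k n 0) c))) =
      scalarToStalk (ι ≫ projStruct k n) p c := by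
  have h1 := fromZeroRingHom_awayToSection (grading k n) hf hm
  have h2 : CommRingCat.ofHom (algebraMap k (grading k n 0)) ≫
      (CommRingCat.ofHom (HomogeneousLocalization.fromZeroRingHom (grading k n) _) ≫
        Proj.awayToSection (grading k n) f) ≫
      (ProjSpace k n).presheaf.germ _ (ι p) hp ≫ ι.stalkMap p =
      (Scheme.ΓSpecIso _).inv ≫ (ι ≫ projStruct k n).appTop ≫
        H.presheaf.germ ⊤ p trivial := by
    rw [h1, Category.assoc, Category.assoc, Scheme.ΓSpecIso_inv_naturality_assoc,
      TopCat.Presheaf.germ_res_assoc, Scheme.Hom.germ_stalkMap, Scheme.Hom.comp_appTop,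
      Scheme.Hom.comp_appTop]
    simp only [Category.assoc]
    rfl
  exact congr($h2 c)

end Scalars

section ChartToStalk

variable {k : Type} [Field k] {n : ℕ} {H : Scheme} (ι : H ⟶ ProjSpace k n) (p : H)
  (hp : ι p ∈ Proj.basicOpen (grading k n) (X (Fin.last n)))

/-- The sections over the standard chart. -/
def chartSection (k : Type) [Field k] (n : ℕ) : MvPolynomial (Fin n) k →+*
    Γ(ProjSpace k n, Proj.basicOpen (grading k n) (X (Fin.last n))) :=
  (Proj.awayToSection (grading k n) (X (Fin.last n))).hom.comp (chartHom k n)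

theorem chartSection_bijective : Function.Bijective (chartSection k n) := by
  have h : Proj.awayToSection (grading k n) (X (Fin.last n)) =
      (Proj.basicOpenIsoAway (grading k n) (X (Fin.last n)) (X_mem_grading k n _) one_pos).hom :=
    rfl
  refine Function.Bijective.comp (g := Proj.awayToSection (grading k n) (X (Fin.last n))) ?_
    chartHom_bijective
  rw [h]
  exact ConcreteCategory.bijective_of_isIso _

theorem mem_basicOpen_chartSection_dehom_iff {F : MvPolynomial (Fin (n + 1)) k} {j : ℕ}
    (hF : F.IsHomogeneous j) {x : ProjSpace k n}
    (hx : x ∈ Proj.basicOpen (grading k n) (X (Fin.last n))) :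
    x ∈ (ProjSpace k n).basicOpen (chartSection k n (dehom k n F)) ↔
      F ∉ x.asHomogeneousIdeal := by
  have hF' : F ∈ grading k n (j • 1) := by simpa using hF
  rw [← mem_basicOpen_awayToSection_iff (grading k n) (X_mem_grading k n (Fin.last n)) j F hF' hx,
    ← chartHom_dehom hF']
  rfl

/-- The homomorphism from the coordinate ring of the standard chart to the stalk of `H`. -/
def chartToStalk : MvPolynomial (Fin n) k →+* H.presheaf.stalk p :=
  (toStalk ι p _ hp).comp (chartSection k n)

theorem chartToStalk_C (c : k) :
    chartToStalk ι p hp (C c) = scalarToStalk (ι ≫ projStruct k n) p c := by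
  rw [← toStalk_awayToSection_fromZeroRingHom ι p (X_mem_grading k n _) one_pos hp, ← chartHom_C]
  rfl

theorem IsHypersurface.isLocalRingOfHypersurface {F : MvPolynomial (Fin (n + 1)) k}
    (h : IsHypersurface F H ι) {d : ℕ} (hF : F.IsHomogeneous d)
    (hX : ∀ i : Fin n, X i.castSucc ∈ (ι p).asHomogeneousIdeal)
    {r : MvPolynomial (Fin n) k} (hr : IsRadicalGenerator (dehom k n F) r) :
    IsLocalRingOfHypersurface (chartToStalk ι p hp) r := by
  have := h.isClosedImmersion
  have := h.reduced
  have hU := Proj.isAffineOpen_basicOpen (grading k n) (X (Fin.last n))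
    (X_mem_grading k n _) one_pos
  have hunit : ∀ s, IsUnit (chartToStalk ι p hp s) ↔ constantCoeff s ≠ 0 := by
    refine isUnit_map_iff_constantCoeff _ fun i hi ↦ ?_
    have h1 : ι p ∈ (ProjSpace k n).basicOpen (chartSection k n (X i)) :=
      (isUnit_toStalk_iff ι p _ hp _).1 hi
    have h2 := mem_basicOpen_chartSection_dehom_iff (isHomogeneous_X k i.castSucc) hp
    rw [dehom_X_castSucc] at h2
    exact h2.1 h1 (hX i)
  let e := RingEquiv.ofBijective (chartSection k n) chartSection_bijective
  refine ⟨hunit, fun t ↦ ?_, fun a ↦ ?_⟩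
  · obtain ⟨a, s, hs, hts⟩ := exists_toStalk_mul_eq ι p _ hp hU t
    obtain ⟨a, rfl⟩ := e.surjective a
    obtain ⟨s, rfl⟩ := e.surjective s
    exact ⟨a, s, (hunit s).1 hs, hts⟩
  · have hz := toStalk_eq_zero_iff ι p _ hp hU (e (dehom k n F)) ?_ (e a)
    · refine hz.trans ⟨?_, ?_⟩
      · rintro ⟨s, hs, hsa⟩
        obtain ⟨s, rfl⟩ := e.surjective s
        refine ⟨s, (hunit s).1 hs, (hr _).2 ?_⟩
        obtain ⟨m, hm⟩ := hsa
        rw [Ideal.mem_span_singleton, ← map_mul, ← map_pow, map_dvd_iff] at hm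
        exact ⟨m, hm⟩
      · rintro ⟨s, hs, hsa⟩
        obtain ⟨m, hm⟩ := (hr _).1 hsa
        refine ⟨e s, (hunit s).2 hs, m, ?_⟩
        rwa [Ideal.mem_span_singleton, ← map_mul, ← map_pow, map_dvd_iff]
    · intro x hx
      refine Iff.trans ?_ (not_iff_not.2 (mem_basicOpen_chartSection_dehom_iff hF hx)).symm
      rw [not_not]
      exact Set.ext_iff.1 h.range_eq x

end ChartToStalk

theorem IsLocalRingOfHypersurface.exists_not_isUnit_sub {σ k L : Type*} [Field k] [CommRing L]
    {ψ : MvPolynomial σ k →+* L} {h : MvPolynomial σ k} (H : IsLocalRingOfHypersurface ψ h)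
    (r : L) : ∃ c, ¬ IsUnit (r - ψ (C c)) := by
  obtain ⟨a, s, hs, hrs⟩ := H.exists_mul_eq r
  refine ⟨constantCoeff a / constantCoeff s, fun hu ↦ ?_⟩
  have h1 := hu.mul ((H.isUnit_iff s).2 hs)
  rw [sub_mul, hrs, ← map_mul, ← map_sub, H.isUnit_iff] at h1
  exact h1 (by simp [div_mul_cancel₀ _ hs])

theorem exists_sub_mem_asHomogeneousIdeal {k : Type} [Field k] {n : ℕ} {H : Scheme}
    (ι : H ⟶ ProjSpace k n) (p : H)
    (hk : ∀ r, ∃ c, ¬ IsUnit (r - scalarToStalk (ι ≫ projStruct k n) p c))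
    {i : Fin (n + 1)} (hi : X i ∉ (ι p).asHomogeneousIdeal) (j : Fin (n + 1)) :
    ∃ c, X j - C c * X i ∈ (ι p).asHomogeneousIdeal := by
  have hp : ι p ∈ Proj.basicOpen (grading k n) (X i) := hi
  have hm (l) : l ∈ grading k n 1 → l ∈ grading k n (1 • 1) := by simp
  obtain ⟨c, hc⟩ := hk (toStalk ι p _ hp (Proj.awayToSection (grading k n) (X i)
    (HomogeneousLocalization.Away.mk _ (X_mem_grading k n i) 1 (X j)
      (hm _ (X_mem_grading k n j)))))
  refine ⟨c, ?_⟩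
  have hl : X j - C c * X i ∈ grading k n 1 :=
    sub_mem (X_mem_grading k n j) (by simpa using (isHomogeneous_C _ c).mul (isHomogeneous_X k i))
  rw [← toStalk_awayToSection_fromZeroRingHom ι p (X_mem_grading k n i) one_pos hp, ← map_sub,
    ← map_sub] at hc
  have h1 : HomogeneousLocalization.Away.mk _ (X_mem_grading k n i) 1 (X j)
      (hm _ (X_mem_grading k n j)) -
      HomogeneousLocalization.fromZeroRingHom _ _ (algebraMap k (grading k n 0) c) =
      HomogeneousLocalization.Away.mk _ (X_mem_grading k n i) 1 _ (hm _ hl) := by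
    apply HomogeneousLocalization.val_injective
    rw [HomogeneousLocalization.val_sub, HomogeneousLocalization.Away.val_mk,
      HomogeneousLocalization.Away.val_mk]
    have : (HomogeneousLocalization.fromZeroRingHom (grading k n) (Submonoid.powers (X i))
      (algebraMap k (grading k n 0) c)).val = Localization.mk (C c) 1 := rfl
    rw [this, Localization.sub_mk]
    simp [mul_comm]
  rw [h1, isUnit_toStalk_iff, mem_basicOpen_awayToSection_iff _ _ _ _ _ hp, not_not] at hc
  exact hc

section ProjMap

variable {k : Type} [Field k] {n : ℕ}
  {E : MvPolynomial (Fin (n + 1)) k ≃ₐ[k] MvPolynomial (Fin (n + 1)) k}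

/-- A linear change of coordinates as a homomorphism of graded rings. -/
def IsLinearChange.gradedRingHom (hE : IsLinearChange E) : grading k n →+*ᵍ grading k n where
  __ := (E : MvPolynomial (Fin (n + 1)) k →+* MvPolynomial (Fin (n + 1)) k)
  map_mem := hE.isHomogeneous

theorem IsLinearChange.irrelevant_le (hE : IsLinearChange E) :
    HomogeneousIdeal.irrelevant (grading k n) ≤
      (HomogeneousIdeal.irrelevant (grading k n)).map hE.gradedRingHom := by
  rw [HomogeneousIdeal.irrelevant_le]
  intro i hi x hx
  have h : hE.gradedRingHom (E.symm x) = x := E.apply_symm_apply x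
  rw [← h]
  exact Ideal.mem_map_of_mem _
    (HomogeneousIdeal.mem_irrelevant_of_mem _ hi (hE.symm.isHomogeneous hx))

/-- The automorphism of projective space attached to a linear change of coordinates. -/
def IsLinearChange.projMap (hE : IsLinearChange E) : ProjSpace k n ⟶ ProjSpace k n :=
  Proj.map hE.gradedRingHom hE.irrelevant_le

theorem IsLinearChange.mem_projMap_iff (hE : IsLinearChange E) (x : ProjSpace k n)
    (F : MvPolynomial (Fin (n + 1)) k) :
    F ∈ (hE.projMap x).asHomogeneousIdeal ↔ E F ∈ x.asHomogeneousIdeal :=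
  Iff.rfl

theorem IsLinearChange.projMap_comp_symm (hE : IsLinearChange E) :
    hE.projMap ≫ hE.symm.projMap = 𝟙 _ := by
  have h : hE.gradedRingHom.comp hE.symm.gradedRingHom = .id (grading k n) := by
    exact GradedRingHom.ext fun x ↦ E.apply_symm_apply x
  have key : ∀ (φ : grading k n →+*ᵍ grading k n) (hφ), φ = .id (grading k n) →
      Proj.map φ hφ = 𝟙 _ := by
    rintro _ _ rfl
    exact Proj.map_id
  rw [projMap, projMap, ← Proj.map_comp]
  exact key _ _ h

instance IsLinearChange.isIso_projMap (hE : IsLinearChange E) : IsIso hE.projMap :=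
  ⟨hE.symm.projMap, hE.projMap_comp_symm, hE.symm.projMap_comp_symm⟩

theorem IsLinearChange.projMap_projStruct (hE : IsLinearChange E) :
    hE.projMap ≫ projStruct k n = projStruct k n := by
  have key : ∀ (i : ℕ) (hi : 0 < i) (a : MvPolynomial (Fin (n + 1)) k) (ha : a ∈ grading k n i),
      Proj.awayι (grading k n) (hE.gradedRingHom a) (hE.gradedRingHom.2 ha) hi ≫
        Proj.map hE.gradedRingHom hE.irrelevant_le ≫ projStruct k n =
      Proj.awayι (grading k n) (hE.gradedRingHom a) (hE.gradedRingHom.2 ha) hi ≫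
        projStruct k n := by
    intro i hi a ha
    rw [Proj.awayι_comp_map_assoc _ _ hi _ ha, Proj.awayι_toSpecZero_assoc,
      Proj.awayι_toSpecZero_assoc, ← Spec.map_comp, ← Spec.map_comp, ← Spec.map_comp]
    congr 1
    ext c
    have h1 : ∀ h, Localization.mk (E (C c)) ⟨E 1, h⟩ =
        Localization.mk (C c) (1 : Submonoid.powers (hE.gradedRingHom a)) := by
      simp only [map_one, ← algebraMap_eq, AlgEquiv.commutes]
      exact fun _ ↦ rfl
    exact h1 _
  exact (Proj.mapAffineOpenCover _ hE.irrelevant_le).openCover.hom_ext _ _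
    fun s ↦ key _ s.1.2 _ s.2.2

theorem IsHypersurface.comp_projMap {F : MvPolynomial (Fin (n + 1)) k} {H : Scheme}
    {ι : H ⟶ ProjSpace k n} (h : IsHypersurface F H ι) (hE : IsLinearChange E) :
    IsHypersurface (E.symm F) H (ι ≫ hE.projMap) := by
  have := h.isClosedImmersion
  refine ⟨inferInstance, h.reduced, ?_⟩
  ext x
  constructor
  · rintro ⟨q, rfl⟩
    have hq : F ∈ (ι q).asHomogeneousIdeal := Set.ext_iff.1 h.range_eq (ι q) |>.1 ⟨q, rfl⟩
    change E.symm F ∈ (hE.projMap (ι q)).asHomogeneousIdeal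
    rwa [hE.mem_projMap_iff, E.apply_symm_apply]
  · intro hx
    obtain ⟨q, hq⟩ := (Set.ext_iff.1 h.range_eq (hE.symm.projMap x)).2 hx
    refine ⟨q, ?_⟩
    change hE.projMap (ι q) = x
    have h1 := congr($hE.symm.projMap_comp_symm x)
    rwa [Scheme.Hom.comp_apply, ← hq] at h1

end ProjMap

section Existence

theorem isReduced_subscheme_vanishingIdeal {X : Scheme} (Z : TopologicalSpace.Closeds X) :
    IsReduced (Scheme.IdealSheafData.vanishingIdeal Z).subscheme := by
  let I := Scheme.IdealSheafData.vanishingIdeal Z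
  have h (U : X.affineOpens) : IsReduced (I.subschemeCover.openCover.X U) := by
    have : _root_.IsReduced (X.presheaf.obj (.op U.1) ⧸ I.ideal U) := by
      rw [← Ideal.isRadical_iff_quotient_reduced, Scheme.IdealSheafData.vanishingIdeal_ideal]
      exact PrimeSpectrum.isRadical_vanishingIdeal _
    exact inferInstanceAs (IsReduced (Spec (CommRingCat.of
      (X.presheaf.obj (.op U.1) ⧸ I.ideal U))))
  have : ∀ U, IsReduced (I.subschemeCover.openCover.X U) := h
  exact IsReduced.of_openCover _ I.subschemeCover.openCover

variable {k : Type} [Field k] {n : ℕ}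

theorem exists_isHypersurface (F : MvPolynomial (Fin (n + 1)) k) :
    ∃ (H : Scheme) (ι : H ⟶ ProjSpace k n), IsHypersurface F H ι := by
  let Z := (Proj.basicOpen (grading k n) F).compl
  refine ⟨_, (Scheme.IdealSheafData.vanishingIdeal Z).subschemeι, inferInstance,
    isReduced_subscheme_vanishingIdeal Z, ?_⟩
  refine (Scheme.IdealSheafData.range_subschemeι _).trans ?_
  rw [Scheme.IdealSheafData.coe_support_vanishingIdeal]
  ext x
  exact not_not

theorem IsHypersurface.comp_iso {F : MvPolynomial (Fin (n + 1)) k} {H H' : Scheme}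
    {ι : H ⟶ ProjSpace k n} (h : IsHypersurface F H ι) (e : H' ≅ H) :
    IsHypersurface F H' (e.hom ≫ ι) := by
  have := h.isClosedImmersion
  have := h.reduced
  refine ⟨inferInstance, isReduced_of_isOpenImmersion e.hom, ?_⟩
  rw [← h.range_eq]
  ext x
  constructor
  · rintro ⟨q, rfl⟩
    exact ⟨e.hom q, rfl⟩
  · rintro ⟨q, rfl⟩
    obtain ⟨q, rfl⟩ := e.hom.surjective q
    exact ⟨q, rfl⟩

theorem IsHypersurface.congr {F G : MvPolynomial (Fin (n + 1)) k} {H : Scheme}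
    {ι : H ⟶ ProjSpace k n} (h : IsHypersurface F H ι)
    (hFG : zeroLocusSet k n F = zeroLocusSet k n G) : IsHypersurface G H ι :=
  ⟨h.isClosedImmersion, h.reduced, h.range_eq.trans hFG⟩

theorem zeroLocusSet_subset_of_dvd_pow {F G : MvPolynomial (Fin (n + 1)) k} {m : ℕ}
    (h : F ∣ G ^ m) : zeroLocusSet k n F ⊆ zeroLocusSet k n G := fun x hx ↦
  x.isPrime.mem_of_pow_mem m (Ideal.mem_of_dvd _ h hx)

theorem IsRadicalGenerator.zeroLocusSet_eq {f r : MvPolynomial (Fin (n + 1)) k}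
    (h : IsRadicalGenerator f r) : zeroLocusSet k n r = zeroLocusSet k n f := by
  obtain ⟨m, hm⟩ := h.dvd_pow
  exact (zeroLocusSet_subset_of_dvd_pow (m := 1) (by simpa using h.dvd)).antisymm
    (zeroLocusSet_subset_of_dvd_pow hm)

/-- A linear change of coordinates carrying one equation to another, up to a nonzero constant,
makes the hypersurfaces isomorphic. -/
theorem IsLinearChange.exists_isHypersurface_isoOver
    {E : MvPolynomial (Fin (n + 1)) k ≃ₐ[k] MvPolynomial (Fin (n + 1)) k}
    (hE : IsLinearChange E) {f g : MvPolynomial (Fin (n + 1)) k} {c : k} (hc : c ≠ 0)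
    (h : E f = C c * g) :
    ∃ (H H' : Scheme) (ι : H ⟶ ProjSpace k n) (ι' : H' ⟶ ProjSpace k n),
      IsHypersurface f H ι ∧ IsHypersurface g H' ι' ∧
      IsoOver (ι ≫ projStruct k n) (ι' ≫ projStruct k n) := by
  obtain ⟨H, ι, hι⟩ := exists_isHypersurface f
  refine ⟨H, H, ι, ι ≫ hE.symm.projMap, hι, (hι.comp_projMap hE.symm).congr ?_, Iso.refl H, ?_⟩
  · have hfg : E.symm.symm f = C c * g := h
    rw [hfg]
    refine (zeroLocusSet_subset_of_dvd_pow (m := 1) ⟨C c⁻¹, ?_⟩).antisymm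
      (zeroLocusSet_subset_of_dvd_pow (m := 1) ⟨C c, ?_⟩)
    · rw [mul_right_comm, ← C_mul, mul_inv_cancel₀ hc, C_1, one_mul, pow_one]
    · rw [pow_one, mul_comm]
  · rw [Iso.refl_hom, Category.id_comp, Category.assoc, hE.symm.projMap_projStruct]

end Existence

namespace MvPolynomial

theorem totalDegree_aeval_le {σ τ k : Type*} [CommSemiring k] {v : σ → MvPolynomial τ k}
    (hv : ∀ i, (v i).totalDegree ≤ 1) (p : MvPolynomial σ k) :
    (aeval v p).totalDegree ≤ p.totalDegree := by
  rw [aeval_def, eval₂_eq]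
  refine totalDegree_finsetSum_le fun s hs ↦ (totalDegree_mul _ _).trans ?_
  rw [algebraMap_eq, totalDegree_C, zero_add]
  refine (totalDegree_finsetProd _ _).trans (le_trans (Finset.sum_le_sum fun i _ ↦ ?_)
    (le_totalDegree hs))
  exact (totalDegree_pow _ _).trans (by simpa using Nat.mul_le_mul_left (s i) (hv i))

theorem totalDegree_dehom_le {k : Type} [Field k] {n : ℕ} (p : MvPolynomial (Fin (n + 1)) k) :
    (dehom k n p).totalDegree ≤ p.totalDegree := by
  refine totalDegree_aeval_le (fun i ↦ ?_) p
  induction i using Fin.lastCases with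
  | last => simp
  | cast i => simp

/-- The coordinate change fixing `X i` and adding the multiple `c j` of `X i` to every other
variable `X j`. -/
def shear {σ k : Type*} [DecidableEq σ] [Field k] (i : σ) (c : σ → k) :
    MvPolynomial σ k ≃ₐ[k] MvPolynomial σ k :=
  AlgEquiv.ofAlgHom (aeval fun j ↦ X j + if j = i then 0 else C (c j) * X i)
    (aeval fun j ↦ X j - if j = i then 0 else C (c j) * X i)
    (by ext1 j; by_cases h : j = i <;> simp [h, ← algebraMap_eq])
    (by ext1 j; by_cases h : j = i <;> simp [h, ← algebraMap_eq])

section Shear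

variable {σ k : Type*} [DecidableEq σ] [Field k] (i : σ) (c : σ → k)

theorem shear_X (j : σ) :
    shear i c (X j) = X j + if j = i then 0 else C (c j) * X i := by simp [shear]

theorem shear_symm_X (j : σ) :
    (shear i c).symm (X j) = X j - if j = i then 0 else C (c j) * X i := by simp [shear]

theorem isLinearChange_shear : IsLinearChange (shear i c) := by
  have h (j) : (if j = i then 0 else C (c j) * X i : MvPolynomial σ k).IsHomogeneous 1 := by
    split_ifs
    · exact isHomogeneous_zero _ _ _
    · exact (isHomogeneous_X k i).C_mul _
  refine ⟨fun j ↦ ?_, fun j ↦ ?_⟩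
  · rw [shear_X]
    exact (isHomogeneous_X k j).add (h j)
  · rw [shear_symm_X]
    exact (isHomogeneous_X k j).sub (h j)

theorem shear_rename {τ : Type*} [DecidableEq τ] {u : σ → τ} (hu : Function.Injective u)
    (c : τ → k) (p : MvPolynomial σ k) :
    shear (u i) c (rename u p) = rename u (shear i (c ∘ u) p) := by
  have : (shear (u i) c : MvPolynomial τ k →ₐ[k] _).comp (rename u) =
      (rename u).comp (shear i (c ∘ u) : MvPolynomial σ k →ₐ[k] _) := by
    ext1 j
    by_cases h : j = i <;> simp [shear_X, h, hu.eq_iff]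
  exact congr($this p)

end Shear

section SwapLast

variable {k : Type} [Field k] {n : ℕ} (i : Fin (n + 1))

/-- The homogeneous polynomial `p`, with the variable `X i` renamed to the additional variable. -/
def renameToLast : MvPolynomial (Fin (n + 1)) k →ₐ[k] MvPolynomial (Fin (n + 2)) k :=
  rename (Equiv.swap i.castSucc (Fin.last (n + 1)) ∘ Fin.castSucc)

theorem eq_of_renameToLast_eq_rename_castSucc {p q : MvPolynomial (Fin (n + 1)) k}
    (h : renameToLast i p = rename Fin.castSucc q) : p = q := by
  let u : Fin (n + 2) → Fin (n + 1) := Fin.lastCases i id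
  have hu : u ∘ Fin.castSucc = id := by ext1 j; simp [u]
  have hu' : u ∘ Equiv.swap i.castSucc (Fin.last (n + 1)) ∘ Fin.castSucc = id := by
    ext1 j
    by_cases hj : j = i
    · simp [u, hj]
    · have h2 : j.castSucc ≠ i.castSucc := by simpa using hj
      simp [u, Equiv.swap_apply_of_ne_of_ne h2 (Fin.castSucc_lt_last j).ne]
  have h1 := congrArg (rename u) h
  rwa [renameToLast, rename_rename, rename_rename, hu, hu', rename_id_apply, rename_id_apply] at h1

theorem IsHomogeneous.eq_of_dehom_renameToLast {p : MvPolynomial (Fin (n + 1)) k} {e : ℕ}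
    (hp : p.IsHomogeneous e) (h : (dehom k (n + 1) (renameToLast i p)).IsHomogeneous e) :
    p = dehom k (n + 1) (renameToLast i p) :=
  eq_of_renameToLast_eq_rename_castSucc i <|
    hp.rename_isHomogeneous.eq_of_dehom_eq h.rename_isHomogeneous (dehom_rename _).symm

theorem IsHomogeneous.dehom_renameToLast_ne_zero {p : MvPolynomial (Fin (n + 1)) k} {e : ℕ}
    (hp : p.IsHomogeneous e) (hp0 : p ≠ 0) : dehom k (n + 1) (renameToLast i p) ≠ 0 := by
  intro h
  have h1 := hp.eq_of_dehom_renameToLast i (by rw [h]; exact isHomogeneous_zero _ _ _)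
  exact hp0 (h1.trans h)

theorem totalDegree_dehom_renameToLast_le (p : MvPolynomial (Fin (n + 1)) k) :
    (dehom k (n + 1) (renameToLast i p)).totalDegree ≤ p.totalDegree :=
  (totalDegree_dehom_le _).trans (totalDegree_rename_le _ _)

/-- If a divisor of the dehomogenization of `p` with respect to `X i` is homogeneous of degree at
least the degree of `p`, then it is `p` up to a constant. -/
theorem IsHomogeneous.exists_eq_C_mul_of_dvd_dehom {p r : MvPolynomial (Fin (n + 1)) k} {e : ℕ}
    (hp : p.IsHomogeneous p.totalDegree) (hp0 : p ≠ 0) (hr : r.IsHomogeneous e)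
    (he : p.totalDegree ≤ e) (hrp : r ∣ dehom k (n + 1) (renameToLast i p)) :
    ∃ c ≠ 0, p = C c * r := by
  obtain ⟨u, hu⟩ := hrp
  have h0 := hp.dehom_renameToLast_ne_zero i hp0
  rw [hu] at h0
  have hle := totalDegree_dehom_renameToLast_le i p
  rw [hu, totalDegree_mul_of_isDomain (left_ne_zero_of_mul h0) (right_ne_zero_of_mul h0),
    hr.totalDegree (left_ne_zero_of_mul h0)] at hle
  have hC : u = C (coeff 0 u) := totalDegree_eq_zero_iff_eq_C.1 (by omega)
  rw [hC, mul_comm] at hu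
  have h1 := hp.eq_of_dehom_renameToLast i
    (by rw [hu, show p.totalDegree = e by omega]; exact hr.C_mul _)
  refine ⟨coeff 0 u, fun h ↦ right_ne_zero_of_mul h0 ?_, h1.trans hu⟩
  rw [hC, h, C_0]

end SwapLast

end MvPolynomial

section Cone

variable {k : Type} [Field k] {n : ℕ}

/-- The homomorphism evaluating every variable but the last at `0`. -/
def evalLast (k : Type) [Field k] (n : ℕ) : MvPolynomial (Fin (n + 1)) k →ₐ[k] Polynomial k :=
  aeval (Fin.lastCases Polynomial.X 0)

theorem ker_evalLast : RingHom.ker (evalLast k n) =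
    Ideal.span (Set.range fun i : Fin n ↦ (X i.castSucc : MvPolynomial (Fin (n + 1)) k)) := by
  set I := Ideal.span (Set.range fun i : Fin n ↦ (X i.castSucc : MvPolynomial (Fin (n + 1)) k))
    with hI
  refine le_antisymm (fun F hF ↦ ?_) (Ideal.span_le.2 ?_)
  · have key : ((Ideal.Quotient.mkₐ k I).comp (Polynomial.aeval (X (Fin.last n)))).comp
        (evalLast k n) = Ideal.Quotient.mkₐ k I := by
      ext1 i
      induction i using Fin.lastCases with
      | last => simp [evalLast]
      | cast i =>
        have : Ideal.Quotient.mkₐ k I (X i.castSucc) = 0 :=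
          Ideal.Quotient.eq_zero_iff_mem.2 (Ideal.subset_span ⟨i, rfl⟩)
        rw [this]
        simp [evalLast]
    refine Ideal.Quotient.eq_zero_iff_mem.1 ((congr($key F)).symm.trans ?_)
    rw [RingHom.mem_ker] at hF
    simp [hF]
  · rintro _ ⟨i, rfl⟩
    simp [RingHom.mem_ker, evalLast]

/-- The point `[0 : … : 0 : 1]` of projective space. -/
theorem exists_coordinate_point (k : Type) [Field k] (n : ℕ) :
    ∃ x : ProjSpace k n, (∀ i : Fin n, X i.castSucc ∈ x.asHomogeneousIdeal) ∧
      X (Fin.last n) ∉ x.asHomogeneousIdeal := by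
  let I := RingHom.ker (evalLast k n)
  have hI : I.IsHomogeneous (grading k n) := by
    rw [show I = _ from ker_evalLast]
    refine Ideal.homogeneous_span _ _ ?_
    rintro _ ⟨i, rfl⟩
    exact ⟨1, X_mem_grading k n _⟩
  have hprime : I.IsPrime := RingHom.ker_isPrime _
  have hlast : X (Fin.last n) ∉ I := by simp [I, RingHom.mem_ker, evalLast]
  exact ⟨⟨⟨I, hI⟩, hprime, fun h ↦ hlast
    (h (HomogeneousIdeal.mem_irrelevant_of_mem _ one_pos (X_mem_grading k n _)))⟩,
    fun i ↦ (by simp [I, RingHom.mem_ker, evalLast] : X i.castSucc ∈ I), hlast⟩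

theorem mem_idealOfVars_of_isHomogeneous {σ k : Type*} [Field k] {f : MvPolynomial σ k} {d : ℕ}
    (hf : f.IsHomogeneous d) (hd : d ≠ 0) : f ∈ idealOfVars σ k :=
  (mem_idealOfVars_iff f).2 (hf.coeff_eq_zero (by simpa using hd.symm))

theorem exists_X_notMem_asHomogeneousIdeal (x : ProjSpace k n) :
    ∃ i, X i ∉ x.asHomogeneousIdeal := by
  by_contra! h
  refine x.not_irrelevant_le ((HomogeneousIdeal.irrelevant_le _).2 fun i hi F hF ↦ ?_)
  refine (Ideal.span_le.2 ?_ : idealOfVars (Fin (n + 1)) k ≤ x.asHomogeneousIdeal.toIdeal)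
    (mem_idealOfVars_of_isHomogeneous hF hi.ne')
  rintro _ ⟨j, rfl⟩
  exact h j

theorem rename_castSucc_mem_asHomogeneousIdeal {f : MvPolynomial (Fin n) k} {d : ℕ}
    (hf : f.IsHomogeneous d) (hd : d ≠ 0) {x : ProjSpace k n}
    (hx : ∀ i : Fin n, X i.castSucc ∈ x.asHomogeneousIdeal) :
    rename Fin.castSucc f ∈ x.asHomogeneousIdeal := by
  refine (Ideal.map_le_iff_le_comap.2 ?_ : (idealOfVars (Fin n) k).map (rename Fin.castSucc) ≤
    x.asHomogeneousIdeal.toIdeal)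
    (Ideal.mem_map_of_mem _ (mem_idealOfVars_of_isHomogeneous hf hd))
  refine Ideal.span_le.2 ?_
  rintro _ ⟨i, rfl⟩
  simpa using hx i

end Cone

section Comparison

variable {k : Type} [Field k] {n d : ℕ}

theorem IsRadicalGenerator.totalDegree_pos {σ k : Type*} [Field k] {f r : MvPolynomial σ k}
    {d : ℕ} (h : IsRadicalGenerator f r) (hf : f.IsHomogeneous d) (hf0 : f ≠ 0) (hd : 1 ≤ d) :
    1 ≤ r.totalDegree := by
  obtain ⟨m, u, hu⟩ := h.dvd_pow
  have hr0 := h.ne_zero hf0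
  by_contra! hr
  have h1 := (totalDegree_pow r m).trans_eq (by rw [Nat.lt_one_iff.1 hr, mul_zero])
  have hu0 : u ≠ 0 := right_ne_zero_of_mul (hu ▸ pow_ne_zero m hr0)
  rw [hu, totalDegree_mul_of_isDomain hf0 hu0, hf.totalDegree hf0] at h1
  omega

theorem exists_isLinearChange_of_totalDegree_le {f g r s : MvPolynomial (Fin (n + 1)) k}
    (hd : 1 ≤ d) (hf : f.IsHomogeneous d) (hg : g.IsHomogeneous d) (hf0 : f ≠ 0) (hg0 : g ≠ 0)
    {H : Scheme} {ι₁ ι₂ : H ⟶ ProjSpace k (n + 1)}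
    (h₁ : IsHypersurface (rename Fin.castSucc f) H ι₁)
    (h₂ : IsHypersurface (rename Fin.castSucc g) H ι₂)
    (hι : ι₁ ≫ projStruct k (n + 1) = ι₂ ≫ projStruct k (n + 1))
    (hr : IsRadicalGenerator f r) (hs : IsRadicalGenerator g s)
    (hsr : s.totalDegree ≤ r.totalDegree) :
    ∃ E : MvPolynomial (Fin (n + 1)) k ≃ₐ[k] MvPolynomial (Fin (n + 1)) k,
      IsLinearChange E ∧ ∃ c ≠ 0, E r = C c * s := by
  have hrhom := hr.isHomogeneous hf0 hf
  have hshom := hs.isHomogeneous hg0 hg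
  have hr0 := hr.ne_zero hf0
  have hs0 := hs.ne_zero hg0
  have hr1 := hr.totalDegree_pos hf hf0 hd
  obtain ⟨v, hv, hvlast⟩ := exists_coordinate_point k (n + 1)
  obtain ⟨p, rfl⟩ := (Set.ext_iff.1 h₁.range_eq v).2
    (rename_castSucc_mem_asHomogeneousIdeal hf (by omega) hv)
  replace hvlast : ι₁ p ∈ Proj.basicOpen (grading k (n + 1)) (X (Fin.last (n + 1))) := hvlast
  have hr' : IsRadicalGenerator (dehom k (n + 1) (rename Fin.castSucc f)) r := by
    rwa [dehom_rename]
  have loc₁ := h₁.isLocalRingOfHypersurface ι₁ p hvlast hf.rename_isHomogeneous hv hr'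
  have vertex {G : MvPolynomial (Fin (n + 2)) k} {ι : H ⟶ ProjSpace k (n + 1)}
      (hG : G.IsHomogeneous d)
      (h : IsHypersurface G H ι) (hι : ι₁ ≫ projStruct k (n + 1) = ι ≫ projStruct k (n + 1))
      (hX : ∀ j : Fin (n + 1), X j.castSucc ∈ (ι p).asHomogeneousIdeal)
      (hlast : ι p ∈ Proj.basicOpen (grading k (n + 1)) (X (Fin.last (n + 1))))
      {t : MvPolynomial (Fin (n + 1)) k} (ht : IsRadicalGenerator (dehom k (n + 1) G) t) (ht0 : t ≠ 0)
      (htr : t.totalDegree ≤ r.totalDegree) : t.IsHomogeneous r.totalDegree ∧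
        ∃ E : MvPolynomial (Fin (n + 1)) k ≃ₐ[k] MvPolynomial (Fin (n + 1)) k,
          IsLinearChange E ∧ ∃ c ≠ 0, E r = C c * t := by
    refine loc₁.exists_isLinearChange (h.isLocalRingOfHypersurface ι p hlast hG hX ht)
      (fun c ↦ ?_) hr0 ht0 hrhom hr1 htr
    rw [chartToStalk_C, chartToStalk_C, hι]
  have hrat : ∀ a, ∃ c, ¬ IsUnit (a - scalarToStalk (ι₂ ≫ projStruct k (n + 1)) p c) := by
    intro a
    obtain ⟨c, hc⟩ := loc₁.exists_not_isUnit_sub a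
    rw [chartToStalk_C, hι] at hc
    exact ⟨c, hc⟩
  by_cases hX : ∀ j : Fin (n + 1), X j.castSucc ∈ (ι₂ p).asHomogeneousIdeal
  · refine (vertex hg.rename_isHomogeneous h₂ hι hX ?_ (by rwa [dehom_rename]) hs0 hsr).2
    obtain ⟨j, hj⟩ := exists_X_notMem_asHomogeneousIdeal (ι₂ p)
    induction j using Fin.lastCases with
    | last => exact hj
    | cast j => exact (hj (hX j)).elim
  · push Not at hX
    obtain ⟨i, hi⟩ := hX
    choose b hb using fun j ↦ exists_sub_mem_asHomogeneousIdeal ι₂ p hrat hi j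
    let σ := Equiv.swap i.castSucc (Fin.last (n + 1))
    let E₀ := (renameEquiv k σ).trans (shear i.castSucc b).symm
    have hE₀ : IsLinearChange E₀ :=
      (isLinearChange_renameEquiv σ).trans (isLinearChange_shear _ b).symm
    have hη := isLinearChange_shear i (b ∘ Fin.castSucc)
    set η := shear i (b ∘ Fin.castSucc)
    have hsymm (P : MvPolynomial (Fin (n + 1)) k) :
        E₀.symm (rename Fin.castSucc P) = renameToLast i (η P) := by
      change (renameEquiv k σ).symm (shear i.castSucc b (rename Fin.castSucc P)) = _
      rw [shear_rename i (Fin.castSucc_injective _)]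
      simp [renameToLast, rename_rename, σ, η]
    have hE₀X {j : Fin (n + 2)} (hj : σ j ≠ i.castSucc) :
        X j ∈ (hE₀.projMap (ι₂ p)).asHomogeneousIdeal := by
      rw [hE₀.mem_projMap_iff]
      change (shear i.castSucc b).symm (renameEquiv k σ (X j)) ∈ _
      rw [renameEquiv_apply, rename_X, shear_symm_X, if_neg hj]
      exact hb _
    have hE₀last : X (Fin.last (n + 1)) ∉ (hE₀.projMap (ι₂ p)).asHomogeneousIdeal := by
      rw [hE₀.mem_projMap_iff]
      change (shear i.castSucc b).symm (renameEquiv k σ (X (Fin.last (n + 1)))) ∉ _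
      rw [renameEquiv_apply, rename_X, shear_symm_X, Equiv.swap_apply_right, if_pos rfl, sub_zero]
      exact hi
    have hg' := (hη.isHomogeneous hg).dehom_renameToLast_ne_zero i (by simpa using hg0)
    have hs' := (hη.isHomogeneous hshom).dehom_renameToLast_ne_zero i (by simpa using hs0)
    obtain ⟨t, ht⟩ := exists_isRadicalGenerator hg'
    have hts : t ∣ dehom k (n + 1) (renameToLast i (η s)) := by
      obtain ⟨m, hm⟩ := hs.dvd_pow
      have h := map_dvd (dehom k (n + 1)) (map_dvd (renameToLast i) (map_dvd η hm))
      rw [map_pow, map_pow, map_pow] at h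
      exact (ht _).2 ⟨m, h⟩
    have hηs : (η s).totalDegree = s.totalDegree :=
      (hη.isHomogeneous hshom).totalDegree (by simpa using hs0)
    have hdeg : t.totalDegree ≤ r.totalDegree := by
      refine (totalDegree_le_of_dvd_of_isDomain hts hs').trans ?_
      exact (totalDegree_dehom_renameToLast_le i _).trans (hηs.trans_le hsr)
    rw [← hsymm] at ht
    obtain ⟨hthom, E, hE, c, hc, hErt⟩ := vertex (ι := ι₂ ≫ hE₀.projMap)
      (hE₀.symm.isHomogeneous hg.rename_isHomogeneous) (h₂.comp_projMap hE₀)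
      (by rw [Category.assoc, hE₀.projMap_projStruct, hι])
      (fun j ↦ hE₀X ((Equiv.swap_apply_eq_iff.trans (by rw [Equiv.swap_apply_left])).not.2
        (Fin.castSucc_lt_last j).ne)) hE₀last ht (ht.ne_zero (by rwa [hsymm])) hdeg
    obtain ⟨a, ha, hst⟩ := (hηs ▸ hη.isHomogeneous hshom).exists_eq_C_mul_of_dvd_dehom i
      (by simpa using hs0) hthom (hηs.trans_le hsr) hts
    refine ⟨E.trans η.symm, hE.trans hη.symm, c * a⁻¹, mul_ne_zero hc (inv_ne_zero ha), ?_⟩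
    apply η.injective
    have hη' : η (η.symm (E r)) = C c * t := (η.apply_symm_apply _).trans hErt
    have hηC : η (C (c * a⁻¹)) = C (c * a⁻¹) := η.commutes _
    rw [map_mul, hst, hηC, ← mul_assoc, ← C_mul, inv_mul_cancel_right₀ ha]
    exact hη'

theorem exists_isLinearChange_of_isHypersurface {f g r s : MvPolynomial (Fin (n + 1)) k}
    (hd : 1 ≤ d) (hf : f.IsHomogeneous d) (hg : g.IsHomogeneous d) (hf0 : f ≠ 0) (hg0 : g ≠ 0)
    {H : Scheme} {ι₁ ι₂ : H ⟶ ProjSpace k (n + 1)}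
    (h₁ : IsHypersurface (rename Fin.castSucc f) H ι₁)
    (h₂ : IsHypersurface (rename Fin.castSucc g) H ι₂)
    (hι : ι₁ ≫ projStruct k (n + 1) = ι₂ ≫ projStruct k (n + 1))
    (hr : IsRadicalGenerator f r) (hs : IsRadicalGenerator g s) :
    ∃ E : MvPolynomial (Fin (n + 1)) k ≃ₐ[k] MvPolynomial (Fin (n + 1)) k,
      IsLinearChange E ∧ ∃ c ≠ 0, E r = C c * s := by
  obtain h | h := le_total s.totalDegree r.totalDegree
  · exact exists_isLinearChange_of_totalDegree_le hd hf hg hf0 hg0 h₁ h₂ hι hr hs h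
  · obtain ⟨E, hE, c, hc, h⟩ :=
      exists_isLinearChange_of_totalDegree_le hd hg hf hg0 hf0 h₂ h₁ hι.symm hs hr h
    refine ⟨E.symm, hE.symm, c⁻¹, inv_ne_zero hc, ?_⟩
    have hC : E (C c⁻¹) = C c⁻¹ := E.commutes _
    rw [AlgEquiv.symm_apply_eq, map_mul, h, hC, ← mul_assoc, ← C_mul, inv_mul_cancel₀ hc, C_1,
      one_mul]

end Comparison

/-- **Lemma 3.7.**  Let `f, g ∈ k[x_0, …, x_n]` be (nonzero) homogeneous polynomials of
the same degree `d ≥ 1`, regarded also as homogeneous polynomials in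
`k[x_0, …, x_{n+1}]`.  If `V(f) ⊆ ℙ^{n+1}` and `V(g) ⊆ ℙ^{n+1}` are isomorphic, then
`V(f) ⊆ ℙⁿ` and `V(g) ⊆ ℙⁿ` are isomorphic. -/
theorem stmt10 (k : Type) [Field k] (n d : ℕ) (hn : 1 ≤ n) (hd : 1 ≤ d)
    (f g : MvPolynomial (Fin (n + 1)) k)
    (hf0 : f ≠ 0) (hfd : f.IsHomogeneous d)
    (hg0 : g ≠ 0) (hgd : g.IsHomogeneous d)
    (hiso : ∃ (H H' : Scheme) (ι : H ⟶ ProjSpace k (n + 1)) (ι' : H' ⟶ ProjSpace k (n + 1)),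
      IsHypersurface (rename Fin.castSucc f) H ι ∧
      IsHypersurface (rename Fin.castSucc g) H' ι' ∧
      IsoOver (ι ≫ projStruct k (n + 1)) (ι' ≫ projStruct k (n + 1))) :
    ∃ (H H' : Scheme) (ι : H ⟶ ProjSpace k n) (ι' : H' ⟶ ProjSpace k n),
      IsHypersurface f H ι ∧ IsHypersurface g H' ι' ∧
      IsoOver (ι ≫ projStruct k n) (ι' ≫ projStruct k n) := by
  obtain ⟨H, H', ι, ι', h, h', e, he⟩ := hiso
  obtain ⟨r, hr⟩ := exists_isRadicalGenerator hf0
  obtain ⟨s, hs⟩ := exists_isRadicalGenerator hg0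
  obtain ⟨E, hE, c, hc, hrs⟩ := exists_isLinearChange_of_isHypersurface hd hfd hgd hf0 hg0 h
    (h'.comp_iso e) (by rw [Category.assoc, he]) hr hs
  obtain ⟨K, K', κ, κ', hκ, hκ', hiso⟩ := hE.exists_isHypersurface_isoOver hc hrs
  exact ⟨K, K', κ, κ', hκ.congr hr.zeroLocusSet_eq, hκ'.congr hs.zeroLocusSet_eq, hiso⟩

end
end

section
/- Let k be a field, let d ≥ 4 be an integer not divisible by char(k), let μ ∈ k, and let f = x^{d−1} y + z^d and g = x^{d−1} y + z^d + μ x^{d−2} z^2 in k[x, y, z]. If α: V(f) → V(g) is an isomorphism between the curves V(f), V(g) ⊆ P^2, then μ = 0 and α is given by [x : y : z] ↦ [a^d x : y : a^{d−1} z] for some a ∈ k^*. -/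
/-!
Common set-up: projective `n`-space over a field `k` as the scheme
`Proj k[x_0, …, x_n]`, complements of hypersurfaces as open subschemes,
hypersurfaces as reduced closed subschemes, and isomorphisms of varieties
over `k` as scheme isomorphisms commuting with the structure morphisms
to `Spec k`.
-/

open AlgebraicGeometry CategoryTheory MvPolynomial

attribute [local instance] MvPolynomial.gradedAlgebra

noncomputable section

section PointsAndStalks

/-- The homogeneous prime ideal of a point of projective space. -/
abbrev primeAt {k : Type} [Field k] {n : ℕ} (x : ProjSpace k n) :
    Ideal (MvPolynomial (Fin (n + 1)) k) :=
  (x : ProjectiveSpectrum (grading k n)).asHomogeneousIdeal.toIdeal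

instance {k : Type} [Field k] {n : ℕ} (x : ProjSpace k n) : (primeAt x).IsPrime :=
  ProjectiveSpectrum.isPrime x

/-- The constants of a `k`-scheme in its stalk at a point. -/
def constGerm {k : Type} [Field k] {H : Scheme} (s : H ⟶ SpecK k) (x : H) :
    k →+* H.presheaf.stalk x :=
  ((Scheme.ΓSpecIso (CommRingCat.of k)).inv ≫ s.appTop ≫ H.presheaf.germ ⊤ x trivial).hom

/-- Homogeneous fractions regular at `j x`, as elements of the stalk at `x`. -/
def fracGerm {k : Type} [Field k] {n : ℕ} {H : Scheme} (j : H ⟶ ProjSpace k n) (x : H) :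
    HomogeneousLocalization.AtPrime (grading k n) (primeAt (j x)) →+* H.presheaf.stalk x :=
  (j.stalkMap x).hom.comp (Proj.stalkIso' (grading k n) (j x)).symm.toRingHom

variable {k : Type} [Field k] {n : ℕ} {H : Scheme} (j : H ⟶ ProjSpace k n)

lemma fracGerm_surjective [IsClosedImmersion j] (x : H) :
    Function.Surjective (fracGerm j x) :=
  (j.stalkMap_surjective x).comp (Proj.stalkIso' (grading k n) (j x)).symm.surjective

lemma isUnit_fracGerm_iff (x : H) (a) : IsUnit (fracGerm j x a) ↔ IsUnit a := by
  have h1 : IsUnit (j.stalkMap x ((Proj.stalkIso' (grading k n) (j x)).symm a)) ↔ _ :=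
    isUnit_map_iff (j.stalkMap x).hom _
  refine h1.trans ?_
  exact MulEquiv.isUnit_map (Proj.stalkIso' (grading k n) (j x)).symm

lemma stalkSpecializes_fracGerm {x y : H} (h : x ⤳ y)
    (c : HomogeneousLocalization.NumDenSameDeg (grading k n) (primeAt (j y)).primeCompl)
    (hc : (c.den : MvPolynomial (Fin (n + 1)) k) ∈ (primeAt (j x)).primeCompl) :
    H.presheaf.stalkSpecializes h (fracGerm j y (.mk c)) =
      fracGerm j x (.mk ⟨c.deg, c.num, c.den, hc⟩) := by
  have := Scheme.Hom.stalkSpecializes_stalkMap_apply j x y h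
    ((Proj.stalkIso' (grading k n) (j y)).symm (.mk c))
  refine this.symm.trans ?_
  change j.stalkMap x _ = j.stalkMap x _
  congr 1
  apply (Proj.stalkIso' (grading k n) (j x)).injective
  refine Eq.trans ?_ ((Proj.stalkIso' (grading k n) (j x)).apply_symm_apply _).symm
  refine Eq.trans (congrArg _ (TopCat.Presheaf.germ_stalkSpecializes_apply
    _ _ _ _)) ?_
  exact Proj.stalkIso'_germ ..

lemma topIso_inv_isoOfEq_inv_toSpecΓ {X Z : Scheme} (U : X.Opens) (e : U = ⊤)
    (f : Spec Γ(X, U) ⟶ Z) :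
    X.topIso.inv ≫ (X.isoOfEq e).inv ≫ U.toSpecΓ ≫ f =
      X.toSpecΓ ≫ Spec.map (X.presheaf.map (eqToHom e.symm).op) ≫ f := by
  subst e
  simp

lemma constGerm_projStruct :
    (Scheme.ΓSpecIso (CommRingCat.of k)).inv ≫ (projStruct k n).appTop =
      CommRingCat.ofHom (algebraMap k (grading k n 0)) ≫
       CommRingCat.ofHom (HomogeneousLocalization.fromZeroRingHom (grading k n) _) ≫
       Proj.awayToSection (grading k n) 1 ≫
       (ProjSpace k n).presheaf.map (eqToHom (Proj.basicOpen_one (grading k n)).symm).op := by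
  have h : projStruct k n = (ProjSpace k n).toSpecΓ ≫ Spec.map (
      CommRingCat.ofHom (algebraMap k (grading k n 0)) ≫
       CommRingCat.ofHom (HomogeneousLocalization.fromZeroRingHom (grading k n) _) ≫
       Proj.awayToSection (grading k n) 1 ≫
       (ProjSpace k n).presheaf.map (eqToHom (Proj.basicOpen_one (grading k n)).symm).op) := by
    simp only [projStruct, Proj.toSpecZero, Proj.basicOpenToSpec, Spec.map_comp, Category.assoc]
    exact topIso_inv_isoOfEq_inv_toSpecΓ ..
  rw [h, Scheme.Hom.comp_appTop, ← Scheme.ΓSpecIso_inv_naturality_assoc, Scheme.toSpecΓ_appTop]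
  simp only [Iso.inv_hom_id, Category.comp_id]

lemma constGerm_comp (x : H) (c : k) :
    constGerm (j ≫ projStruct k n) x c = fracGerm j x
      (.mk ⟨0, ⟨C c, isHomogeneous_C _ _⟩, ⟨1, isHomogeneous_one _ _⟩, one_mem _⟩) := by
  have hp : constGerm (j ≫ projStruct k n) x c = j.stalkMap x (constGerm (projStruct k n) (j x) c) := by
    simp only [constGerm, Scheme.Hom.comp_appTop, CommRingCat.hom_comp, RingHom.comp_apply]
    exact (Scheme.Hom.germ_stalkMap_apply j ⊤ x trivial _).symm
  rw [hp]
  change j.stalkMap x _ = j.stalkMap x _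
  congr 1
  apply (Proj.stalkIso' (grading k n) (j x)).injective
  refine Eq.trans ?_ ((Proj.stalkIso' (grading k n) (j x)).apply_symm_apply _).symm
  refine (Proj.stalkIso'_germ _ _ _ _ _).trans ?_
  have := congrArg (fun f => f.hom c) (constGerm_projStruct (k := k) (n := n))
  simp only [CommRingCat.hom_comp, RingHom.comp_apply] at this
  refine (congrFun (congrArg Subtype.val this) ⟨j x, trivial⟩).trans ?_
  refine (Proj.res_apply ..).trans ?_
  rfl

/-- The fraction `h / w` of homogeneous polynomials of the same degree. -/
def homFrac {P : Ideal (MvPolynomial (Fin (n + 1)) k)} [P.IsPrime] (m : ℕ)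
    (h w : MvPolynomial (Fin (n + 1)) k) (hh : h.IsHomogeneous m) (hw : w.IsHomogeneous m)
    (hwP : w ∉ P) : HomogeneousLocalization.AtPrime (grading k n) P :=
  .mk ⟨m, ⟨h, hh⟩, ⟨w, hw⟩, hwP⟩

lemma val_homFrac {P : Ideal (MvPolynomial (Fin (n + 1)) k)} [P.IsPrime] {m : ℕ}
    {h w : MvPolynomial (Fin (n + 1)) k} (hh : h.IsHomogeneous m) (hw : w.IsHomogeneous m)
    (hwP : w ∉ P) : (homFrac m h w hh hw hwP).val =
      IsLocalization.mk' (Localization P.primeCompl) h (⟨w, hwP⟩ : P.primeCompl) := by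
  rw [homFrac, HomogeneousLocalization.val_mk, Localization.mk_eq_mk']

lemma isUnit_homFrac_iff {P : Ideal (MvPolynomial (Fin (n + 1)) k)} [P.IsPrime] {m : ℕ}
    {h w : MvPolynomial (Fin (n + 1)) k} (hh : h.IsHomogeneous m) (hw : w.IsHomogeneous m)
    (hwP : w ∉ P) : IsUnit (homFrac m h w hh hw hwP) ↔ h ∉ P := by
  rw [← HomogeneousLocalization.isUnit_iff_isUnit_val, val_homFrac,
    IsLocalization.AtPrime.isUnit_mk'_iff _ P]
  rfl

/-- Dehomogenization with respect to `X 0`. -/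
def dehomogenize (P : Ideal (MvPolynomial (Fin (n + 1)) k)) [P.IsPrime] (h0 : X 0 ∉ P) :
    MvPolynomial (Fin (n + 1)) k →+* HomogeneousLocalization.AtPrime (grading k n) P :=
  eval₂Hom ((HomogeneousLocalization.fromZeroRingHom (grading k n) _).comp
    (algebraMap k (grading k n 0)))
    (fun i => homFrac 1 (X i) (X 0) (isHomogeneous_X _ _) (isHomogeneous_X _ _) h0)

lemma dehomogenize_apply {P : Ideal (MvPolynomial (Fin (n + 1)) k)} [P.IsPrime] (h0 : X 0 ∉ P)
    {m : ℕ} {h : MvPolynomial (Fin (n + 1)) k} (hh : h.IsHomogeneous m) :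
    dehomogenize P h0 h = homFrac m h (X 0 ^ m) hh (isHomogeneous_X_pow _ _)
      (fun h => h0 (Ideal.IsPrime.mem_of_pow_mem ‹_› _ h)) := by
  apply HomogeneousLocalization.val_injective
  rw [val_homFrac, IsLocalization.eq_mk'_iff_mul_eq]
  let L := Localization P.primeCompl
  let v : HomogeneousLocalization.AtPrime (grading k n) P →+* L := algebraMap _ _
  let a : MvPolynomial (Fin (n + 1)) k →+* L := algebraMap _ _
  have key : (v.comp (dehomogenize P h0)) h * (a (X 0)) ^ m = a h := by
    have hX (i) : v.comp (dehomogenize P h0) (X i) * a (X 0) = a (X i) := by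
      simp only [RingHom.comp_apply, dehomogenize, coe_eval₂Hom, eval₂_X]
      exact (congrArg (· * _) (val_homFrac _ _ _)).trans (IsLocalization.mk'_spec ..)
    have hC (c) : v.comp (dehomogenize P h0) (C c) = a (C c) := by
      simp only [RingHom.comp_apply, dehomogenize, coe_eval₂Hom, eval₂_C]
      exact Localization.mk_one_eq_algebraMap _
    conv_lhs => rw [h.as_sum]
    conv_rhs => rw [h.as_sum]
    simp only [map_sum, Finset.sum_mul]
    refine Finset.sum_congr rfl fun d hd => ?_
    have hdm : d.sum (fun _ e => e) = m := by
      have := hh (mem_support_iff.mp hd)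
      simpa [Finsupp.weight_apply] using this
    rw [monomial_eq, map_mul, map_mul, hC, ← hdm, mul_assoc]
    congr 1
    simp only [Finsupp.prod, Finsupp.sum, map_prod, map_pow, ← Finset.prod_pow_eq_pow_sum,
      ← Finset.prod_mul_distrib, ← mul_pow, hX]
  change _ * algebraMap _ L (X 0 ^ m) = _
  rw [map_pow]
  exact key

/-- A ring homomorphism to the function field of an integral closed subscheme of projective
space that computes the dehomogenization of homogeneous polynomials with respect to `X 0`, and
hence the local rings of the subscheme. -/
structure IsCoordinateHom [IsIntegral H] (ψ : MvPolynomial (Fin (n + 1)) k →+* H.functionField) :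
    Prop where
  map_X_zero : ψ (X 0) = 1
  map_C (c : k) : ψ (C c) = constGerm (j ≫ projStruct k n) (genericPoint H) c
  eq_zero_iff {m : ℕ} {h : MvPolynomial (Fin (n + 1)) k} (hh : h.IsHomogeneous m) :
    ψ h = 0 ↔ h ∈ primeAt (j (genericPoint H))
  exists_stalk (x : H) {m : ℕ} {h w : MvPolynomial (Fin (n + 1)) k} (hh : h.IsHomogeneous m)
    (hw : w.IsHomogeneous m) (hwx : w ∉ primeAt (j x)) : ψ w ≠ 0 ∧ ∃ e : H.presheaf.stalk x,
      algebraMap _ H.functionField e = ψ h / ψ w ∧ (IsUnit e ↔ h ∉ primeAt (j x))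
  exists_frac (x : H) (e : H.presheaf.stalk x) : ∃ (m : ℕ) (h w : MvPolynomial (Fin (n + 1)) k),
    h.IsHomogeneous m ∧ w.IsHomogeneous m ∧ w ∉ primeAt (j x) ∧
      algebraMap _ H.functionField e = ψ h / ψ w

lemma primeAt_mono {x y : H} (h : x ⤳ y) : primeAt (j x) ≤ primeAt (j y) :=
  (ProjectiveSpectrum.as_ideal_le_as_ideal _ _ _).mpr
    ((ProjectiveSpectrum.le_iff_mem_closure _ _ _).mpr (h.map j.continuous).mem_closure)

theorem exists_isCoordinateHom [IsIntegral H] [IsClosedImmersion j]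
    (h0 : X 0 ∉ primeAt (j (genericPoint H))) : ∃ ψ, IsCoordinateHom j ψ := by
  let η := genericPoint H
  let θ : _ →+* H.functionField := fracGerm j η
  let ψ : MvPolynomial (Fin (n + 1)) k →+* H.functionField := θ.comp (dehomogenize _ h0)
  have hspec (x : H) : η ⤳ x := (genericPoint_spec H).specializes trivial
  have hψ {m : ℕ} {h : MvPolynomial (Fin (n + 1)) k} (hh : h.IsHomogeneous m) :
      ψ h = θ (homFrac m h (X 0 ^ m) hh (isHomogeneous_X_pow _ _)
      (fun h => h0 (Ideal.IsPrime.mem_of_pow_mem inferInstance _ h))) :=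
    congrArg θ (dehomogenize_apply h0 hh)
  have hzero {m : ℕ} {h : MvPolynomial (Fin (n + 1)) k} (hh : h.IsHomogeneous m) :
      ψ h = 0 ↔ h ∈ primeAt (j η) := by
    rw [hψ hh, ← not_iff_not, ← isUnit_homFrac_iff hh (isHomogeneous_X_pow _ _),
      ← isUnit_fracGerm_iff j η]
    exact isUnit_iff_ne_zero.symm
  have hdiv (x : H) {m : ℕ} {h w : MvPolynomial (Fin (n + 1)) k} (hh : h.IsHomogeneous m)
      (hw : w.IsHomogeneous m) (hwx : w ∉ primeAt (j x)) : ψ w ≠ 0 ∧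
      algebraMap _ H.functionField (fracGerm j x (homFrac m h w hh hw hwx)) = ψ h / ψ w := by
    have hwη : w ∉ primeAt (j η) := fun h' => hwx (primeAt_mono j (hspec x) h')
    have hne : ψ w ≠ 0 := (hzero hw).not.mpr hwη
    refine ⟨hne, ?_⟩
    rw [eq_div_iff hne]
    have : algebraMap _ H.functionField (fracGerm j x (homFrac m h w hh hw hwx)) =
      θ (homFrac m h w hh hw hwη) :=
      stalkSpecializes_fracGerm j (hspec x) ⟨m, ⟨h, hh⟩, ⟨w, hw⟩, hwx⟩ hwη
    rw [this, hψ hh, hψ hw, ← map_mul]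
    congr 1
    apply HomogeneousLocalization.val_injective
    rw [HomogeneousLocalization.val_mul, val_homFrac, val_homFrac, val_homFrac,
      ← IsLocalization.mk'_mul, IsLocalization.mk'_eq_iff_eq]
    simp only [Submonoid.coe_mul]
    congr 1
    ring
  refine ⟨ψ, ⟨?_, ?_, hzero, ?_, ?_⟩⟩
  · rw [hψ (isHomogeneous_X _ 0)]
    refine Eq.trans (congrArg θ ?_) (map_one θ)
    apply HomogeneousLocalization.val_injective
    rw [val_homFrac, HomogeneousLocalization.val_one, IsLocalization.mk'_eq_iff_eq_mul]
    simp
  · intro c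
    rw [constGerm_comp]
    refine congrArg θ ?_
    simp only [dehomogenize, coe_eval₂Hom, eval₂_C]
    rfl
  · intro x m h w hh hw hwx
    exact ⟨(hdiv x hh hw hwx).1, _, (hdiv x hh hw hwx).2,
      (isUnit_fracGerm_iff j x _).trans (isUnit_homFrac_iff hh hw hwx)⟩
  · intro x e
    obtain ⟨a, rfl⟩ := fracGerm_surjective j x e
    obtain ⟨⟨m, ⟨h, hh⟩, ⟨w, hw⟩, hwx⟩, rfl⟩ := HomogeneousLocalization.mk_surjective a
    exact ⟨m, h, w, hh, hw, hwx, (hdiv x hh hw hwx).2⟩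

namespace IsHypersurface

variable {j} {F : MvPolynomial (Fin (n + 1)) k}

lemma mem_primeAt (hH : IsHypersurface F H j) (x : H) : F ∈ primeAt (j x) := by
  have : j x ∈ zeroLocusSet k n F := hH.range_eq ▸ ⟨x, rfl⟩
  exact this

lemma exists_point (hH : IsHypersurface F H j) (P : Ideal (MvPolynomial (Fin (n + 1)) k))
    (hP : P.IsPrime) (hhom : P.IsHomogeneous (grading k n)) (hF : F ∈ P) {i : Fin (n + 1)}
    (hi : X i ∉ P) : ∃ x : H, primeAt (j x) = P := by
  let y : ProjSpace k n := (⟨⟨P, hhom⟩, hP, fun h => hi <| h <|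
    HomogeneousIdeal.mem_irrelevant_of_mem (grading k n) one_pos (isHomogeneous_X k i)⟩ :
      ProjectiveSpectrum (grading k n))
  have : y ∈ Set.range j.base := hH.range_eq ▸ (hF : y ∈ zeroLocusSet k n F)
  obtain ⟨x, hx⟩ := this
  exact ⟨x, congrArg primeAt hx⟩

lemma eq_of_primeAt_eq (hH : IsHypersurface F H j) {x y : H}
    (h : primeAt (j x) = primeAt (j y)) : x = y := by
  have := hH.isClosedImmersion
  refine j.isClosedEmbedding.injective ?_
  exact ProjectiveSpectrum.ext (HomogeneousIdeal.toIdeal_injective h)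

lemma specializes (hH : IsHypersurface F H j) {x y : H}
    (h : primeAt (j x) ≤ primeAt (j y)) : x ⤳ y := by
  have := hH.isClosedImmersion
  rw [← j.isClosedEmbedding.isInducing.specializes_iff, specializes_iff_mem_closure]
  exact (ProjectiveSpectrum.le_iff_mem_closure _ _ _).mp h

lemma isIntegral (hH : IsHypersurface F H j) (hF : Prime F) {m : ℕ} (hm : F.IsHomogeneous m)
    {i : Fin (n + 1)} (hi : ¬ F ∣ X i) : IsIntegral H ∧
      ∀ η : H, IsGenericPoint η Set.univ → primeAt (j η) = Ideal.span {F} := by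
  obtain ⟨ξ, hξ⟩ := hH.exists_point (Ideal.span {F})
    ((Ideal.span_singleton_prime hF.ne_zero).mpr hF)
    (Ideal.homogeneous_span _ _ (by simpa using ⟨m, hm⟩)) (Ideal.mem_span_singleton_self F)
    (i := i) (by rwa [Ideal.mem_span_singleton])
  have hgen (x : H) : ξ ⤳ x := hH.specializes <| by
    rw [hξ, Ideal.span_singleton_le_iff_mem]
    exact hH.mem_primeAt x
  have hξ' : IsGenericPoint ξ Set.univ :=
    Set.eq_univ_of_forall fun x => (hgen x).mem_closure
  have := hH.reduced
  have : IrreducibleSpace H := by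
    have := isIrreducible_singleton (x := ξ) |>.closure
    rw [hξ'] at this
    exact irreducibleSpace_def _ |>.mpr this
  refine ⟨isIntegral_of_irreducibleSpace_of_isReduced H, fun η hη => ?_⟩
  rw [hη.eq hξ', hξ]

end IsHypersurface

end PointsAndStalks

section Homogeneous

variable {k : Type} [Field k] {n : ℕ}

lemma homogeneousComponent_mem {I : Ideal (MvPolynomial (Fin n) k)}
    (hI : I.IsHomogeneous (homogeneousSubmodule (Fin n) k)) {h : MvPolynomial (Fin n) k}
    (hh : h ∈ I) (i : ℕ) : homogeneousComponent i h ∈ I := by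
  rw [← decomposition.decompose'_apply]
  exact hI i hh

lemma aeval_mul_of_isHomogeneous {A : Type*} [CommRing A] [Algebra k A] {m : ℕ}
    {h : MvPolynomial (Fin n) k} (hh : h.IsHomogeneous m) (c : A) (v : Fin n → A) :
    aeval (fun i => c * v i) h = c ^ m * aeval v h := by
  conv_lhs => rw [h.as_sum]
  conv_rhs => rw [h.as_sum]
  simp only [map_sum, Finset.mul_sum]
  refine Finset.sum_congr rfl fun d hd => ?_
  have hdm : d.sum (fun _ e => e) = m := by
    have := hh (mem_support_iff.mp hd)
    simpa [Finsupp.weight_apply] using this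
  rw [aeval_monomial, aeval_monomial, ← hdm]
  simp only [Finsupp.prod, Finsupp.sum, ← Finset.prod_pow_eq_pow_sum, mul_pow,
    Finset.prod_mul_distrib]
  ring

lemma mem_iff_of_homogeneous_mem_iff {I J : Ideal (MvPolynomial (Fin n) k)}
    (hI : I.IsHomogeneous (homogeneousSubmodule (Fin n) k))
    (hJ : J.IsHomogeneous (homogeneousSubmodule (Fin n) k))
    (H : ∀ (m : ℕ) (h : MvPolynomial (Fin n) k), h.IsHomogeneous m → (h ∈ I ↔ h ∈ J)) : I = J := by
  ext h
  constructor <;> intro hh <;> rw [← sum_homogeneousComponent h] <;>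
    refine Ideal.sum_mem _ fun i _ => ?_
  · exact (H i _ (homogeneousComponent_isHomogeneous i h)).mp (homogeneousComponent_mem hI hh i)
  · exact (H i _ (homogeneousComponent_isHomogeneous i h)).mpr (homogeneousComponent_mem hJ hh i)

lemma isHomogeneous_comap_aeval {I : Ideal (MvPolynomial (Fin n) k)}
    (hI : I.IsHomogeneous (homogeneousSubmodule (Fin n) k)) {v : Fin n → MvPolynomial (Fin n) k}
    (hv : ∀ i, (v i).IsHomogeneous 1) :
    (I.comap (aeval v)).IsHomogeneous (homogeneousSubmodule (Fin n) k) := by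
  have hdeg {m : ℕ} {h : MvPolynomial (Fin n) k} (hh : h.IsHomogeneous m) :
      (aeval v h).IsHomogeneous m := by simpa using hh.aeval v hv
  intro i h hh
  change ((decomposition.decompose' h i : homogeneousSubmodule (Fin n) k i) :
    MvPolynomial (Fin n) k) ∈ _
  rw [decomposition.decompose'_apply]
  have key := homogeneousComponent_mem hI (Ideal.mem_comap.mp hh) i
  rw [Ideal.mem_comap]
  convert key using 1
  conv_rhs => rw [← sum_homogeneousComponent h]
  simp only [map_sum]
  have h1 (j : ℕ) : homogeneousComponent i (aeval v (homogeneousComponent j h)) =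
      if i = j then aeval v (homogeneousComponent j h) else 0 :=
    homogeneousComponent_of_mem (hdeg (homogeneousComponent_isHomogeneous j h))
  simp only [h1, Finset.sum_ite_eq, Finset.mem_range]
  split_ifs with hi
  · rfl
  · rw [homogeneousComponent_eq_zero _ _ (by omega), map_zero]

end Homogeneous

section Curve

variable {k : Type} [Field k]

/-- The equation `x^{d-1} y + z^d + μ x^{d-2} z^2`. -/
abbrev curveEq (d : ℕ) (μ : k) : MvPolynomial (Fin 3) k :=
  X 0 ^ (d - 1) * X 1 + X 2 ^ d + C μ * X 0 ^ (d - 2) * X 2 ^ 2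

/-- Restriction to the parametrization `[1 : -t^d - μ t^2 : t]` of the affine part of the curve. -/
def affineParam (d : ℕ) (μ : k) : MvPolynomial (Fin 3) k →ₐ[k] Polynomial k :=
  aeval ![1, -Polynomial.X ^ d - Polynomial.C μ * Polynomial.X ^ 2, Polynomial.X]

/-- Restriction to the parametrization `[s^d : -1 - μ s^{d-2} : s^{d-1}]` of the curve around
the point `[0 : 1 : 0]`. -/
def cuspParam (d : ℕ) (μ : k) : MvPolynomial (Fin 3) k →ₐ[k] Polynomial k :=
  aeval ![Polynomial.X ^ d, -1 - Polynomial.C μ * Polynomial.X ^ (d - 2), Polynomial.X ^ (d - 1)]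

@[simp] lemma affineParam_X_zero (d : ℕ) (μ : k) : affineParam d μ (X 0) = 1 := by
  simp [affineParam]

@[simp] lemma affineParam_X_one (d : ℕ) (μ : k) : affineParam d μ (X 1) =
    -Polynomial.X ^ d - Polynomial.C μ * Polynomial.X ^ 2 := by
  simp [affineParam]

@[simp] lemma affineParam_X_two (d : ℕ) (μ : k) : affineParam d μ (X 2) = Polynomial.X := by
  simp [affineParam]

@[simp] lemma affineParam_C (d : ℕ) (μ c : k) : affineParam d μ (C c) = Polynomial.C c := by
  simp [affineParam]

@[simp] lemma cuspParam_X_zero (d : ℕ) (μ : k) : cuspParam d μ (X 0) = Polynomial.X ^ d := by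
  simp [cuspParam]

@[simp] lemma cuspParam_X_one (d : ℕ) (μ : k) : cuspParam d μ (X 1) =
    -1 - Polynomial.C μ * Polynomial.X ^ (d - 2) := by
  simp [cuspParam]

@[simp] lemma cuspParam_X_two (d : ℕ) (μ : k) :
    cuspParam d μ (X 2) = Polynomial.X ^ (d - 1) := by
  simp [cuspParam]

lemma affineParam_curveEq (d : ℕ) (μ : k) : affineParam d μ (curveEq d μ) = 0 := by
  simp [curveEq]
  ring

lemma isHomogeneous_curveEq {d : ℕ} (hd : 2 ≤ d) (μ : k) : (curveEq d μ).IsHomogeneous d := by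
  refine IsHomogeneous.add (IsHomogeneous.add ?_ (isHomogeneous_X_pow _ _)) ?_
  · have := (isHomogeneous_X_pow (R := k) (0 : Fin 3) (d - 1)).mul (isHomogeneous_X k (1 : Fin 3))
    rwa [Nat.sub_add_cancel (by omega)] at this
  · have := ((isHomogeneous_C (Fin 3) μ).mul (isHomogeneous_X_pow (0 : Fin 3) (d - 2))).mul
      (isHomogeneous_X_pow (2 : Fin 3) 2)
    rwa [zero_add, Nat.sub_add_cancel (by omega)] at this

/-- The two parametrizations agree under `s = t⁻¹`. -/
lemma aeval_cuspParam {K : Type*} [Field K] [Algebra k K] {t : K} (ht : t ≠ 0) {d : ℕ} (hd : 2 ≤ d)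
    (μ : k) {m : ℕ} {h : MvPolynomial (Fin 3) k} (hh : h.IsHomogeneous m) :
    Polynomial.aeval t⁻¹ (cuspParam d μ h) =
      (t⁻¹ ^ d) ^ m * Polynomial.aeval t (affineParam d μ h) := by
  rw [cuspParam, affineParam, ← AlgHom.comp_apply, ← AlgHom.comp_apply, comp_aeval, comp_aeval,
    ← aeval_mul_of_isHomogeneous hh]
  congr 2
  funext i
  have h1 : t⁻¹ ^ d * t ^ d = 1 := by rw [← mul_pow, inv_mul_cancel₀ ht, one_pow]
  fin_cases i
  · simp
  · have h2 : t⁻¹ ^ d * t ^ 2 = t⁻¹ ^ (d - 2) := by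
      obtain ⟨e, rfl⟩ := Nat.exists_eq_add_of_le hd
      rw [pow_add, Nat.add_sub_cancel_left]
      field_simp
    simp only [Fin.mk_one, Matrix.cons_val_one, Matrix.cons_val_zero, map_sub, map_neg, map_one,
      map_mul, map_pow, Polynomial.aeval_X, Polynomial.aeval_C]
    linear_combination h1 + algebraMap k K μ * h2
  · have h2 : t⁻¹ ^ d * t = t⁻¹ ^ (d - 1) := by
      obtain ⟨e, rfl⟩ := Nat.exists_eq_add_of_le hd
      rw [show 2 + e - 1 = 1 + e by omega, show 2 + e = 1 + (1 + e) by omega, pow_add _ 1]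
      field_simp
    simpa using h2.symm

/-- The gaps of the numerical semigroup generated by `d - 1` and `d`. -/
lemma coeff_cuspParam_eq_zero {d : ℕ} (hd : 2 ≤ d) (h : MvPolynomial (Fin 3) k) {i : ℕ}
    (h1 : 1 ≤ i) (h2 : i ≤ 2 * d - 3) (h3 : i ≠ d - 1) (h4 : i ≠ d) :
    (cuspParam d (0 : k) h).coeff i = 0 := by
  induction h using MvPolynomial.induction_on generalizing i with
  | C a =>
    rw [cuspParam, aeval_C, Polynomial.algebraMap_eq, Polynomial.coeff_C, if_neg (by omega)]
  | add p q hp hq => rw [map_add, Polynomial.coeff_add, hp h1 h2 h3 h4, hq h1 h2 h3 h4, add_zero]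
  | mul_X p j hp =>
    rw [map_mul]
    fin_cases j
    · simp only [Fin.zero_eta, cuspParam_X_zero, Polynomial.coeff_mul_X_pow']
      split_ifs with hi
      · exact hp (by omega) (by omega) (by omega) (by omega)
      · rfl
    · simpa using hp h1 h2 h3 h4
    · simp only [Fin.reduceFinMk, cuspParam_X_two, Polynomial.coeff_mul_X_pow']
      split_ifs with hi
      · exact hp (by omega) (by omega) (by omega) (by omega)
      · rfl

lemma prime_curveEq {d : ℕ} (hd : 4 ≤ d) (μ : k) : Prime (curveEq d μ) := by
  have hX : Prime (X 0 : MvPolynomial (Fin 3) k) := X_prime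
  rw [curveEq, add_assoc]
  refine (irreducible_mul_X_add _ _ _ (pow_ne_zero _ hX.ne_zero) (fun h => ?_) (fun h => ?_)
    (IsRelPrime.pow_left (hX.irreducible.isRelPrime_iff_not_dvd.mpr ?_))).prime
  · simpa using vars_pow _ _ h
  · have hpow (i : Fin 3) (e : ℕ) (hi : 1 ∈ (X i ^ e : MvPolynomial (Fin 3) k).vars) : 1 = i := by
      simpa using vars_pow _ _ hi
    rcases Finset.mem_union.mp (vars_add_subset _ _ h) with h | h
    · exact absurd (hpow _ _ h) (by decide)
    rcases Finset.mem_union.mp (vars_mul _ _ h) with h | h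
    · rcases Finset.mem_union.mp (vars_mul _ _ h) with h | h
      · simp at h
      · exact absurd (hpow _ _ h) (by decide)
    · exact absurd (hpow _ _ h) (by decide)
  · rintro ⟨c, hc⟩
    have := congrArg (eval ![0, 0, 1]) hc
    simp [show d - 2 ≠ 0 by omega] at this

lemma not_curveEq_dvd_X_zero {d : ℕ} (hd : 4 ≤ d) (μ : k) : ¬ curveEq d μ ∣ X 0 := by
  rintro ⟨c, hc⟩
  have := congrArg (eval ![1, 0, 0]) hc
  simp [curveEq, show d ≠ 0 by omega] at this

end Curve

section Model

/-- The points of a curve with equation `curveEq d μ`, described by homogeneous prime ideals `P x`,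
together with its local rings `O x` in the function field `K`, their non-units `N x`, and the
affine coordinate function `t`, the value of `X 2 / X 0`. -/
structure IsCurveModel {k : Type} [Field k] {K : Type} [Field K] [Algebra k K] (d : ℕ) (μ : k)
    {H : Type} (O : H → Subring K) (N : H → Set K) (P : H → Ideal (MvPolynomial (Fin 3) k))
    (t : K) : Prop where
  isPrime (x : H) : (P x).IsPrime
  isHomogeneous (x : H) : (P x).IsHomogeneous (homogeneousSubmodule (Fin 3) k)
  curveEq_mem (x : H) : curveEq d μ ∈ P x
  exists_X_notMem (x : H) : ∃ i, X i ∉ P x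
  injective : Function.Injective P
  exists_point (Q : Ideal (MvPolynomial (Fin 3) k)) (hQ : Q.IsPrime)
    (hhom : Q.IsHomogeneous (homogeneousSubmodule (Fin 3) k)) (hF : curveEq d μ ∈ Q)
    {i : Fin 3} (hi : X i ∉ Q) : ∃ x, P x = Q
  injective_aeval : Function.Injective (Polynomial.aeval (R := k) t)
  exists_eq_div (e : K) : ∃ p q : Polynomial k, q ≠ 0 ∧
    e = Polynomial.aeval t p / Polynomial.aeval t q
  div_mem (x : H) {m : ℕ} {h w : MvPolynomial (Fin 3) k} (hh : h.IsHomogeneous m)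
    (hw : w.IsHomogeneous m) (hwx : w ∉ P x) :
    Polynomial.aeval t (affineParam d μ w) ≠ 0 ∧
    Polynomial.aeval t (affineParam d μ h) / Polynomial.aeval t (affineParam d μ w) ∈ O x ∧
    (Polynomial.aeval t (affineParam d μ h) / Polynomial.aeval t (affineParam d μ w) ∈ N x ↔
      h ∈ P x)
  exists_div (x : H) {e : K} (he : e ∈ O x) : ∃ (m : ℕ) (h w : MvPolynomial (Fin 3) k),
    h.IsHomogeneous m ∧ w.IsHomogeneous m ∧ w ∉ P x ∧
    e = Polynomial.aeval t (affineParam d μ h) / Polynomial.aeval t (affineParam d μ w)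

variable {k : Type} [Field k] {K : Type} [Field K] [Algebra k K] {d : ℕ} {H : Type}
  {O : H → Subring K} {N : H → Set K}

lemma exists_coprime_div {t e : K} (h : ∃ p q : Polynomial k, q ≠ 0 ∧
    e = Polynomial.aeval t p / Polynomial.aeval t q)
    (ht : Function.Injective (Polynomial.aeval (R := k) t)) :
    ∃ p q : Polynomial k, IsCoprime p q ∧ q ≠ 0 ∧
    e = Polynomial.aeval t p / Polynomial.aeval t q := by
  obtain ⟨p, q, hq, rfl⟩ := h
  classical
  let := EuclideanDomain.gcdMonoid (Polynomial k)
  have hg : GCDMonoid.gcd p q ≠ 0 := gcd_ne_zero_of_right hq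
  have hp' := EuclideanDomain.mul_div_cancel' hg (GCDMonoid.gcd_dvd_left p q)
  have hq' := EuclideanDomain.mul_div_cancel' hg (GCDMonoid.gcd_dvd_right p q)
  refine ⟨_, _, isCoprime_div_gcd_div_gcd (p := p) hq, ?_, ?_⟩
  · intro h
    exact hq (by rw [← hq', h, mul_zero])
  · have hg' : Polynomial.aeval t (GCDMonoid.gcd p q) ≠ 0 :=
      fun h => hg (ht (h.trans (map_zero _).symm))
    rw [← mul_div_mul_left (Polynomial.aeval t (p / GCDMonoid.gcd p q)) _ hg', ← map_mul, ← map_mul, hp', hq']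

namespace IsCurveModel

section

variable {μ : k} {P : H → Ideal (MvPolynomial (Fin 3) k)} {t : K}

lemma X_two_mem (hd : 4 ≤ d) (M : IsCurveModel d μ O N P t) {x : H} (h0 : X 0 ∈ P x) :
    X 2 ∈ P x := by
  have := M.isPrime x
  have hmul (e : ℕ) (he : e ≠ 0) (q : MvPolynomial (Fin 3) k) : X 0 ^ e * q ∈ P x :=
    Ideal.mul_mem_right _ _ (Ideal.pow_mem_of_mem _ h0 e (by omega))
  have h1 := hmul (d - 1) (by omega) (X 1)
  have h2 := hmul (d - 2) (by omega) (C μ * X 2 ^ 2)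
  have h3 := (P x).sub_mem ((P x).sub_mem (M.curveEq_mem x) h1) h2
  refine this.mem_of_pow_mem d ?_
  convert h3 using 1
  simp only [curveEq]
  ring

lemma X_one_notMem (hd : 4 ≤ d) (M : IsCurveModel d μ O N P t) {x : H} (h0 : X 0 ∈ P x) :
    X 1 ∉ P x := by
  intro h1
  obtain ⟨i, hi⟩ := M.exists_X_notMem x
  fin_cases i
  exacts [hi h0, hi h1, hi (M.X_two_mem hd h0)]

lemma mem_iff_eval (hd : 4 ≤ d) (M : IsCurveModel d μ O N P t) {x : H} (h0 : X 0 ∈ P x)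
    {m : ℕ} {w : MvPolynomial (Fin 3) k} (hw : w.IsHomogeneous m) :
    w ∈ P x ↔ eval ![0, 1, 0] w = 0 := by
  have := M.isPrime x
  have h2 := M.X_two_mem hd h0
  have h1 := M.X_one_notMem hd h0
  let π := Ideal.Quotient.mkₐ k (P x)
  have h : π w = π (X 1) ^ m * algebraMap k _ (eval ![0, 1, 0] w) := by
    have h3 := aeval_mul_of_isHomogeneous hw (π (X 1)) (fun i => algebraMap k _ (![0, 1, 0] i : k))
    have h4 : (aeval fun i => algebraMap k (MvPolynomial (Fin 3) k ⧸ P x) (![0, 1, 0] i : k)) w =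
      algebraMap k _ (eval ![0, 1, 0] w) := by
      exact aeval_algebraMap_apply _ _ _
    rw [← h4, ← h3, aeval_unique π]
    congr 2
    funext i
    fin_cases i
    · simpa [π] using Ideal.Quotient.eq_zero_iff_mem.mpr h0
    · simp
    · simpa [π] using Ideal.Quotient.eq_zero_iff_mem.mpr h2
  rw [← Ideal.Quotient.eq_zero_iff_mem, ← Ideal.Quotient.mkₐ_eq_mk k]
  change π w = 0 ↔ _
  rw [h, mul_eq_zero, or_iff_right]
  · exact map_eq_zero_iff _ (algebraMap k _).injective
  · refine pow_ne_zero _ fun h => h1 ?_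
    exact Ideal.Quotient.eq_zero_iff_mem.mp h

lemma eq_of_X_zero_mem (hd : 4 ≤ d) (M : IsCurveModel d μ O N P t) {x y : H} (hx : X 0 ∈ P x)
    (hy : X 0 ∈ P y) : x = y :=
  M.injective <| mem_iff_of_homogeneous_mem_iff (M.isHomogeneous x) (M.isHomogeneous y)
    fun _ _ hh => (M.mem_iff_eval hd hx hh).trans (M.mem_iff_eval hd hy hh).symm

lemma exists_X_zero_mem (hd : 4 ≤ d) (M : IsCurveModel d μ O N P t) : ∃ x, X 0 ∈ P x := by
  let Q : Ideal (MvPolynomial (Fin 3) k) := RingHom.ker (eval (![0, 1, 0] : Fin 3 → k))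
  have hQ : Q.IsPrime := RingHom.ker_isPrime _
  have hmem {m : ℕ} {h : MvPolynomial (Fin 3) k} (hh : h.IsHomogeneous m)
      (h0 : eval ![0, 1, 0] h = 0) :
      h ∈ (Q.homogeneousCore (homogeneousSubmodule (Fin 3) k)).toIdeal :=
    Ideal.mem_homogeneousCore_of_homogeneous_of_mem ⟨m, hh⟩ h0
  obtain ⟨x, hx⟩ := M.exists_point (Q.homogeneousCore (homogeneousSubmodule (Fin 3) k)).toIdeal
    hQ.homogeneousCore (HomogeneousIdeal.isHomogeneous _)
    (hmem (isHomogeneous_curveEq (by omega) μ)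
      (by simp [curveEq, show d - 1 ≠ 0 by omega, show d ≠ 0 by omega]))
    (i := 1) (fun h => by
      have : eval ![0, 1, 0] (X 1 : MvPolynomial (Fin 3) k) = 0 :=
        Ideal.toIdeal_homogeneousCore_le _ Q h
      simp at this)
  exact ⟨x, hx ▸ hmem (isHomogeneous_X k 0) (by simp)⟩

lemma coeff_zero_cuspParam (hd : 4 ≤ d) (M : IsCurveModel d μ O N P t) {x : H} (h0 : X 0 ∈ P x)
    {m : ℕ} {w : MvPolynomial (Fin 3) k} (hw : w.IsHomogeneous m) (hwx : w ∉ P x) :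
    (cuspParam d μ w).coeff 0 ≠ 0 := by
  have h1 : (cuspParam d μ w).coeff 0 = (-1) ^ m * eval ![0, 1, 0] w := by
    rw [Polynomial.coeff_zero_eq_aeval_zero, cuspParam, ← AlgHom.comp_apply, comp_aeval]
    have h2 := aeval_mul_of_isHomogeneous hw (-1) (![0, 1, 0] : Fin 3 → k)
    refine Eq.trans (congrArg (aeval · w) ?_) h2
    funext i
    fin_cases i
    · simp [show d ≠ 0 by omega]
    · simp [show d - 2 ≠ 0 by omega]
    · simp [show d - 1 ≠ 0 by omega]
  rw [h1, mul_ne_zero_iff]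
  exact ⟨pow_ne_zero _ (by simp), (M.mem_iff_eval hd h0 hw).not.mp hwx⟩

lemma t_ne_zero (M : IsCurveModel d μ O N P t) : t ≠ 0 := by
  rintro rfl
  exact Polynomial.X_ne_zero (M.injective_aeval (a₁ := Polynomial.X) (a₂ := 0) (by simp))

lemma injective_aeval_inv (M : IsCurveModel d μ O N P t) :
    Function.Injective (Polynomial.aeval (R := k) t⁻¹) := by
  have := M.injective_aeval
  rw [← transcendental_iff_injective] at this ⊢
  exact fun h => this (IsAlgebraic.inv_iff.mp h)

/-- Functions regular at `[0 : 1 : 0]` in terms of the parameter `t⁻¹`. -/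
lemma exists_eq_cuspParam (hd : 4 ≤ d) (M : IsCurveModel d μ O N P t) {x : H} (h0 : X 0 ∈ P x)
    {p q : Polynomial k} (hq : q ≠ 0)
    (he : Polynomial.aeval t⁻¹ p / Polynomial.aeval t⁻¹ q ∈ O x) :
    ∃ h w : MvPolynomial (Fin 3) k, (cuspParam d μ w).coeff 0 ≠ 0 ∧
      p * cuspParam d μ w = cuspParam d μ h * q := by
  obtain ⟨m, h, w, hh, hw, hwx, e⟩ := M.exists_div x he
  refine ⟨h, w, M.coeff_zero_cuspParam hd h0 hw hwx, M.injective_aeval_inv ?_⟩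
  rw [map_mul, map_mul, aeval_cuspParam M.t_ne_zero (by omega) μ hw,
    aeval_cuspParam M.t_ne_zero (by omega) μ hh]
  have hq' : Polynomial.aeval t⁻¹ q ≠ 0 :=
    fun h => hq (M.injective_aeval_inv (h.trans (map_zero _).symm))
  rw [div_eq_div_iff hq' (M.div_mem x hh hw hwx).1] at e
  linear_combination (t⁻¹ ^ d) ^ m * e

lemma algebraMap_mem (M : IsCurveModel d μ O N P t) (x : H) (c : k) : algebraMap k K c ∈ O x := by
  have := M.isPrime x
  have := (M.div_mem x (isHomogeneous_C _ c) (isHomogeneous_one _ _)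
    ((Ideal.ne_top_iff_one _).mp this.ne_top)).2.1
  simpa using this

lemma aeval_mem (M : IsCurveModel d μ O N P t) {x : H} {e : K} (he : e ∈ O x)
    (q : Polynomial k) : Polynomial.aeval e q ∈ O x := by
  rw [Polynomial.aeval_eq_sum_range]
  refine sum_mem fun i _ => ?_
  rw [Algebra.smul_def]
  exact mul_mem (M.algebraMap_mem x _) (pow_mem he _)

lemma t_mem (M : IsCurveModel d μ O N P t) {x : H} (h0 : X 0 ∉ P x) : t ∈ O x := by
  simpa using (M.div_mem x (isHomogeneous_X k 2) (isHomogeneous_X k 0) h0).2.1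

/-- The local rings at points of the affine part are integrally closed. -/
lemma mem_of_pow_mem (M : IsCurveModel d μ O N P t) {x : H} (h0 : X 0 ∉ P x) {e : K} {n : ℕ}
    (hn : n ≠ 0) (he : e ^ n ∈ O x) : e ∈ O x := by
  obtain ⟨p, q, hpq, hq, rfl⟩ := exists_coprime_div (M.exists_eq_div e) M.injective_aeval
  obtain ⟨m, h, w, hh, hw, hwx, e⟩ := M.exists_div x he
  have hq' : Polynomial.aeval t q ≠ 0 :=
    fun h => hq (M.injective_aeval (h.trans (map_zero _).symm))
  obtain ⟨hw0, hwO, -⟩ := M.div_mem x (isHomogeneous_X_pow 0 m) hw hwx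
  have hdvd : q ∣ affineParam d μ w := by
    rw [div_pow, div_eq_div_iff (pow_ne_zero _ hq') hw0, ← map_pow, ← map_pow, ← map_mul,
      ← map_mul] at e
    refine (dvd_pow_self q hn).trans ((hpq.symm.pow (m := n) (n := n)).dvd_of_dvd_mul_left ?_)
    exact ⟨_, (M.injective_aeval e).trans (mul_comm _ _)⟩
  obtain ⟨c, hc⟩ := hdvd
  have key : Polynomial.aeval t p / Polynomial.aeval t q =
      Polynomial.aeval t (p * c) * (1 / Polynomial.aeval t (affineParam d μ w)) := by
    rw [hc, map_mul] at hw0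
    rw [hc, map_mul, map_mul]
    have := left_ne_zero_of_mul hw0
    have := right_ne_zero_of_mul hw0
    field_simp
  rw [key]
  refine mul_mem (M.aeval_mem (M.t_mem h0) _) ?_
  simpa using hwO

/-- Functions regular on the affine part are polynomials in `t`. -/
lemma exists_aeval_eq (hd : 4 ≤ d) (M : IsCurveModel d μ O N P t) {e : K}
    (he : ∀ x, X 0 ∉ P x → e ∈ O x) : ∃ τ : Polynomial k, Polynomial.aeval t τ = e := by
  obtain ⟨p, q, hpq, hq, rfl⟩ := exists_coprime_div (M.exists_eq_div e) M.injective_aeval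
  by_cases hu : IsUnit q
  · obtain ⟨c, hc, rfl⟩ := Polynomial.isUnit_iff.mp hu
    refine ⟨p * Polynomial.C c⁻¹, ?_⟩
    rw [map_mul, Polynomial.aeval_C, Polynomial.aeval_C, map_inv₀, div_eq_mul_inv]
  obtain ⟨π, hπ, hπq⟩ := WfDvdMonoid.exists_irreducible_factor hu hq
  let Q : Ideal (MvPolynomial (Fin 3) k) := (Ideal.span {π}).comap (affineParam d μ)
  have : (Ideal.span {π}).IsPrime := (Ideal.span_singleton_prime hπ.ne_zero).mpr hπ.prime
  have hQ : Q.IsPrime := inferInstance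
  have hmemQ (h : MvPolynomial (Fin 3) k) : h ∈ Q ↔ π ∣ affineParam d μ h :=
    Ideal.mem_comap.trans Ideal.mem_span_singleton
  have hle := Ideal.toIdeal_homogeneousCore_le (homogeneousSubmodule (Fin 3) k) Q
  have h0 : X 0 ∉ (Q.homogeneousCore (homogeneousSubmodule (Fin 3) k)).toIdeal := fun h => by
    have := (hmemQ _).mp (hle h)
    rw [affineParam_X_zero] at this
    exact hπ.not_isUnit (isUnit_of_dvd_one this)
  obtain ⟨x, hx⟩ := M.exists_point (Q.homogeneousCore (homogeneousSubmodule (Fin 3) k)).toIdeal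
    hQ.homogeneousCore (HomogeneousIdeal.isHomogeneous _)
    (Ideal.mem_homogeneousCore_of_homogeneous_of_mem
      ⟨d, isHomogeneous_curveEq (by omega) μ⟩ ((hmemQ _).mpr (by simp [affineParam_curveEq])))
    h0
  obtain ⟨m, h, w, hh, hw, hwx, e⟩ := M.exists_div x (he x (hx ▸ h0))
  have hq' : Polynomial.aeval t q ≠ 0 :=
    fun h => hq (M.injective_aeval (h.trans (map_zero _).symm))
  rw [div_eq_div_iff hq' (M.div_mem x hh hw hwx).1, ← map_mul, ← map_mul] at e
  refine absurd (hx ▸ Ideal.mem_homogeneousCore_of_homogeneous_of_mem ⟨m, hw⟩ ?_) hwx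
  refine (hmemQ _).mpr ((hπ.prime.dvd_or_dvd (a := p) ?_).resolve_left fun h' => hπ.not_isUnit ?_)
  · rw [M.injective_aeval e]
    exact hπq.mul_left _
  · exact hpq.isUnit_of_dvd' h' hπq

end

section Pair

variable {μ : k} {P P' : H → Ideal (MvPolynomial (Fin 3) k)} {t t' : K}

lemma X_zero_mem_of_mem (hd : 4 ≤ d) (M : IsCurveModel d 0 O N P t)
    (M' : IsCurveModel d μ O N P' t') {x : H} (h0 : X 0 ∈ P x) : X 0 ∈ P' x := by
  by_contra h0'
  have ht := M.t_ne_zero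
  have h1 : t⁻¹ ^ (d - 1) ∈ O x := by
    have := (M.div_mem x (isHomogeneous_X k 2) (isHomogeneous_X k 1) (M.X_one_notMem hd h0)).2.1
    rw [← neg_mem_iff] at this
    convert this using 1
    obtain ⟨e, rfl⟩ := Nat.exists_eq_add_of_le hd
    rw [show 4 + e - 1 = 3 + e by omega]
    simp
    field_simp
    ring
  have h2 := M'.mem_of_pow_mem h0' (by omega) h1
  obtain ⟨h, w, hw, e⟩ := M.exists_eq_cuspParam hd h0 (p := Polynomial.X) (q := 1) one_ne_zero
    (by simpa using h2)
  have h3 := congrArg (Polynomial.coeff · 1) e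
  simp only [Polynomial.coeff_X_mul, mul_one] at h3
  rw [coeff_cuspParam_eq_zero (by omega) h le_rfl (by omega) (by omega) (by omega)] at h3
  exact hw h3

lemma X_zero_mem_iff (hd : 4 ≤ d) (M : IsCurveModel d 0 O N P t)
    (M' : IsCurveModel d μ O N P' t') {x : H} : X 0 ∈ P x ↔ X 0 ∈ P' x := by
  refine ⟨M.X_zero_mem_of_mem hd M', fun h => ?_⟩
  obtain ⟨y, hy⟩ := M.exists_X_zero_mem hd
  rwa [M'.eq_of_X_zero_mem hd h (M.X_zero_mem_of_mem hd M' hy)]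

lemma exists_affine (hd : 4 ≤ d) (M : IsCurveModel d 0 O N P t)
    (M' : IsCurveModel d μ O N P' t') :
    ∃ a b : k, a ≠ 0 ∧ t' = algebraMap k K a * t + algebraMap k K b := by
  obtain ⟨τ, hτ⟩ := M.exists_aeval_eq hd (e := t') fun x hx =>
    M'.t_mem ((M.X_zero_mem_iff hd M').not.mp hx)
  obtain ⟨τ', hτ'⟩ := M'.exists_aeval_eq hd (e := t) fun x hx =>
    M.t_mem ((M.X_zero_mem_iff hd M').not.mpr hx)
  have hcomp : τ'.comp τ = Polynomial.X := M.injective_aeval <| by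
    rw [Polynomial.aeval_comp, hτ, hτ', Polynomial.aeval_X]
  have hdeg := congrArg Polynomial.natDegree hcomp
  rw [Polynomial.natDegree_comp, Polynomial.natDegree_X] at hdeg
  obtain ⟨a, ha, b, rfl⟩ := Polynomial.natDegree_eq_one.mp (Nat.eq_one_of_mul_eq_one_left hdeg)
  exact ⟨a, b, ha, by rw [← hτ]; simp⟩

lemma const_eq_zero (hd : 4 ≤ d) (hchar : (d : k) ≠ 0) (M : IsCurveModel d 0 O N P t)
    (M' : IsCurveModel d μ O N P' t') {a b : k} (ha : a ≠ 0)
    (ht' : t' = algebraMap k K a * t + algebraMap k K b) : b = 0 ∧ μ = 0 := by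
  obtain ⟨p, hp⟩ := M.exists_X_zero_mem hd
  have hp' := M.X_zero_mem_of_mem hd M' hp
  have h1 := M'.X_one_notMem hd hp'
  have ht := M.t_ne_zero
  let L : Polynomial k := Polynomial.C a + Polynomial.C b * Polynomial.X
  let E : Polynomial k := L ^ d + Polynomial.C μ * Polynomial.X ^ (d - 2) * L ^ 2
  have hL : t' = Polynomial.aeval t⁻¹ L / t⁻¹ := by
    simp [L, ht']
    field_simp
  have hE0 : E.coeff 0 = a ^ d := by
    simp [E, L, Polynomial.coeff_zero_eq_eval_zero, show d - 2 ≠ 0 by omega]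
  have hE1 : E.coeff 1 = d * a ^ (d - 1) * b := by
    have := Polynomial.coeff_derivative E 0
    rw [zero_add, Nat.cast_zero, zero_add, mul_one, Polynomial.coeff_zero_eq_eval_zero] at this
    rw [← this]
    simp [E, L, Polynomial.derivative_pow, show d - 2 ≠ 0 by omega, show d - 2 - 1 ≠ 0 by omega]
  have hE : E ≠ 0 := fun h => pow_ne_zero d ha (by rw [← hE0, h, Polynomial.coeff_zero])
  have hXE : ¬ Polynomial.X ∣ -E := by
    rw [dvd_neg, Polynomial.X_dvd_iff, hE0]
    exact pow_ne_zero d ha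
  have hY : Polynomial.aeval t' (affineParam d μ (X 1)) =
      Polynomial.aeval t⁻¹ (-E) / t⁻¹ ^ d := by
    have hs : t⁻¹ ^ (d - 2) = t⁻¹ ^ d * t ^ 2 := by
      obtain ⟨e, rfl⟩ := Nat.exists_eq_add_of_le hd
      rw [show 4 + e - 2 = 2 + e by omega, show 4 + e = 2 + e + 2 by omega, pow_add _ (2 + e)]
      field_simp
    rw [eq_div_iff (pow_ne_zero d (inv_ne_zero ht))]
    simp only [E, hL, affineParam_X_one, map_sub, map_neg, map_add, map_mul, map_pow,
      Polynomial.aeval_X, Polynomial.aeval_C, hs, div_pow]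
    field_simp
    ring
  have hb : b = 0 := by
    have h2 := (M'.div_mem p (isHomogeneous_X k 0) (isHomogeneous_X k 1) h1).2.1
    rw [hY, affineParam_X_zero, map_one, one_div_div] at h2
    obtain ⟨h, w, hw, e⟩ := M.exists_eq_cuspParam hd hp (p := Polynomial.X ^ d)
      (neg_ne_zero.mpr hE) (by simpa using h2)
    obtain ⟨g, hg⟩ := Polynomial.prime_X.pow_dvd_of_dvd_mul_right d hXE ⟨_, e.symm⟩
    rw [hg, mul_assoc] at e
    have e := mul_left_cancel₀ (pow_ne_zero d Polynomial.X_ne_zero) e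
    have e0 := congrArg (Polynomial.coeff · 0) e
    have e1 := congrArg (Polynomial.coeff · 1) e
    have hg1 : g.coeff 1 = 0 := by
      rw [← Polynomial.coeff_X_pow_mul g d 1, ← hg]
      exact coeff_cuspParam_eq_zero (by omega) _ (by omega) (by omega) (by omega) (by omega)
    simp only [Polynomial.mul_coeff_zero, Polynomial.mul_coeff_one, Polynomial.coeff_neg, hg1,
      hE0, hE1, zero_mul, add_zero] at e0 e1
    rw [coeff_cuspParam_eq_zero (by omega) _ (by omega) (by omega) (by omega) (by omega)] at e1
    have hg0 := left_ne_zero_of_mul (e0 ▸ hw)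
    simpa [hg0, hchar, ha] using e1
  refine ⟨hb, ?_⟩
  have hLb : L = Polynomial.C a := by simp [L, hb]
  have hE' : E = Polynomial.C (a ^ d) + Polynomial.C (μ * a ^ 2) * Polynomial.X ^ (d - 2) := by
    simp only [E, hLb, map_mul, map_pow]
    ring
  have h2 := (M'.div_mem p (isHomogeneous_X k 2) (isHomogeneous_X k 1) h1).2.1
  have hs : t⁻¹ ^ d = t⁻¹ ^ (d - 1) * t⁻¹ := by rw [← pow_succ, Nat.sub_add_cancel (by omega)]
  obtain ⟨h, w, hw, e⟩ := M.exists_eq_cuspParam hd hp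
    (p := Polynomial.X ^ (d - 1) * Polynomial.C a) (neg_ne_zero.mpr hE) (by
      convert h2 using 1
      rw [hY, affineParam_X_two, Polynomial.aeval_X, hL, hLb, hs]
      simp only [map_mul, map_pow, Polynomial.aeval_X, Polynomial.aeval_C]
      field_simp)
  rw [mul_assoc] at e
  obtain ⟨g, hg⟩ := Polynomial.prime_X.pow_dvd_of_dvd_mul_right (d - 1) hXE ⟨_, e.symm⟩
  rw [hg, mul_assoc] at e
  have e := mul_left_cancel₀ (pow_ne_zero (d - 1) Polynomial.X_ne_zero) e
  have e0 := congrArg (Polynomial.coeff · 0) e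
  have e1 := congrArg (Polynomial.coeff · (d - 2)) e
  have hg1 : g.coeff (d - 2) = 0 := by
    rw [← Polynomial.coeff_X_pow_mul g (d - 1) (d - 2), ← hg]
    exact coeff_cuspParam_eq_zero (by omega) _ (by omega) (by omega) (by omega) (by omega)
  simp only [Polynomial.mul_coeff_zero, Polynomial.coeff_neg, hE0, Polynomial.coeff_C_zero] at e0
  have hg0 := left_ne_zero_of_mul (e0 ▸ mul_ne_zero ha hw)
  rw [Polynomial.coeff_C_mul, coeff_cuspParam_eq_zero (by omega) _ (by omega) (by omega) (by omega)
    (by omega), hE', mul_neg, Polynomial.coeff_neg, mul_add, Polynomial.coeff_add,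
    Polynomial.coeff_mul_C, hg1, ← mul_assoc, Polynomial.coeff_mul_X_pow', if_pos le_rfl,
    Nat.sub_self, Polynomial.coeff_mul_C] at e1
  simpa [hg0, ha] using e1

/-- An isomorphism of curves given by scaling the affine coordinate. -/
lemma eq_comap (hd : 4 ≤ d) (M : IsCurveModel d 0 O N P t)
    (M' : IsCurveModel d 0 O N P' t') {a : k} (ha : a ≠ 0) (ht' : t' = algebraMap k K a * t)
    (x : H) : P' x = (P x).comap (aeval (![C (a⁻¹ ^ d) * X 0, X 1, C (a⁻¹ ^ (d - 1)) * X 2] :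
      Fin 3 → MvPolynomial (Fin 3) k)) := by
  set A : MvPolynomial (Fin 3) k →ₐ[k] MvPolynomial (Fin 3) k :=
    aeval ![C (a⁻¹ ^ d) * X 0, X 1, C (a⁻¹ ^ (d - 1)) * X 2] with hA
  have hAhom (i : Fin 3) : (![C (a⁻¹ ^ d) * X 0, X 1, C (a⁻¹ ^ (d - 1)) * X 2] i :
      MvPolynomial (Fin 3) k).IsHomogeneous 1 := by
    fin_cases i
    · exact (zero_add 1).subst ((isHomogeneous_C _ _).mul (isHomogeneous_X k (0 : Fin 3)))
    · exact isHomogeneous_X _ _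
    · exact (zero_add 1).subst ((isHomogeneous_C _ _).mul (isHomogeneous_X k (2 : Fin 3)))
  have hdeg {m : ℕ} {h : MvPolynomial (Fin 3) k} (hh : h.IsHomogeneous m) :
      (A h).IsHomogeneous m := (one_mul m).subst (hh.aeval _ hAhom)
  have haK : algebraMap k K a ≠ 0 := by simpa using ha
  have hval {m : ℕ} {h : MvPolynomial (Fin 3) k} (hh : h.IsHomogeneous m) :
      Polynomial.aeval t' (affineParam d 0 h) =
        (algebraMap k K a ^ d) ^ m * Polynomial.aeval t (affineParam d 0 (A h)) := by
    rw [hA, affineParam, ← AlgHom.comp_apply, ← AlgHom.comp_apply, ← AlgHom.comp_apply,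
      comp_aeval, comp_aeval, comp_aeval, ← aeval_mul_of_isHomogeneous hh]
    congr 2
    funext i
    fin_cases i
    · simp [haK]
    · simp [ht', mul_pow]
    · obtain ⟨e, rfl⟩ := Nat.exists_eq_add_of_le' (show 1 ≤ d by omega)
      simp [ht']
      field_simp
      ring
  obtain ⟨i, hi, hi'⟩ : ∃ i, X i ∉ P' x ∧ A (X i) ∉ P x := by
    have := M.isPrime x
    by_cases h0 : X 0 ∈ P x
    · refine ⟨1, M'.X_one_notMem hd ((M.X_zero_mem_iff hd M').mp h0), ?_⟩
      simpa [hA] using M.X_one_notMem hd h0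
    · refine ⟨0, (M.X_zero_mem_iff hd M').not.mp h0, fun h => h0 ?_⟩
      have hX : X 0 = C (a ^ d) * A (X 0) := by
        rw [hA, aeval_X, Matrix.cons_val_zero, ← mul_assoc, ← C_mul, ← mul_pow,
          mul_inv_cancel₀ ha, one_pow, C_1, one_mul]
      rw [hX]
      exact Ideal.mul_mem_left _ _ h
  refine mem_iff_of_homogeneous_mem_iff (M'.isHomogeneous x)
    (isHomogeneous_comap_aeval (M.isHomogeneous x) hAhom) fun m h hh => ?_
  have := M.isPrime x
  have := M'.isPrime x
  have hw := isHomogeneous_X_pow (R := k) i m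
  have hwx : X i ^ m ∉ P' x := fun h => hi (Ideal.IsPrime.mem_of_pow_mem ‹_› _ h)
  have hwx' : A (X i ^ m) ∉ P x := fun h => hi' <| Ideal.IsPrime.mem_of_pow_mem ‹_› m <| by
    rwa [← map_pow]
  rw [← (M'.div_mem x hh hw hwx).2.2, Ideal.mem_comap,
    ← (M.div_mem x (hdeg hh) (hdeg hw) hwx').2.2, hval hh, hval hw, mul_div_mul_left]
  exact pow_ne_zero _ (pow_ne_zero _ haK)

end Pair

end IsCurveModel

end Model

section CoordinateHom

variable {k : Type} [Field k] {H : Scheme} [IsIntegral H]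

/-- The local ring of an integral scheme at a point, as a subring of the function field. -/
def localSubring (x : H) : Subring H.functionField :=
  (algebraMap (H.presheaf.stalk x) H.functionField).range

/-- The non-units of the local ring of an integral scheme at a point. -/
def localNonunits (x : H) : Set H.functionField :=
  algebraMap (H.presheaf.stalk x) H.functionField '' nonunits (H.presheaf.stalk x)

lemma exists_isHomogeneous_affineParam_eq (d : ℕ) (μ : k) (p : Polynomial k) :
    ∃ (m : ℕ) (h : MvPolynomial (Fin 3) k), h.IsHomogeneous m ∧ affineParam d μ h = p := by
  refine ⟨p.natDegree, ∑ i ∈ Finset.range (p.natDegree + 1),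
    C (p.coeff i) * (X 0 ^ (p.natDegree - i) * X 2 ^ i), ?_, ?_⟩
  · refine IsHomogeneous.sum _ _ _ fun i hi => ?_
    have := (isHomogeneous_C (Fin 3) (p.coeff i)).mul
      ((isHomogeneous_X_pow (R := k) (0 : Fin 3) (p.natDegree - i)).mul
        (isHomogeneous_X_pow (2 : Fin 3) i))
    rwa [zero_add, Nat.sub_add_cancel (by simpa [Nat.lt_succ_iff] using hi)] at this
  · conv_rhs => rw [p.as_sum_range_C_mul_X_pow]
    simp [map_sum]

theorem IsCoordinateHom.isCurveModel {d : ℕ} {μ : k} (hd : 4 ≤ d) {j : H ⟶ ProjSpace k 2}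
    (hH : IsHypersurface (curveEq d μ) H j)
    (hη : primeAt (j (genericPoint H)) = Ideal.span {curveEq d μ})
    {ψ : MvPolynomial (Fin (2 + 1)) k →+* H.functionField} (hψ : IsCoordinateHom j ψ)
    [Algebra k H.functionField] (halg : ∀ c, algebraMap k H.functionField c =
      constGerm (j ≫ projStruct k 2) (genericPoint H) c) :
    IsCurveModel d μ (localSubring (H := H)) localNonunits (fun x => primeAt (j x))
      (ψ (X 2)) := by
  have h1 : ψ (X 1) = -ψ (X 2) ^ d - algebraMap k _ μ * ψ (X 2) ^ 2 := by
    have := (hψ.eq_zero_iff (isHomogeneous_curveEq (by omega) μ)).mpr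
      (hη ▸ Ideal.mem_span_singleton_self _)
    simp only [curveEq, map_add, map_mul, map_pow, hψ.map_X_zero, hψ.map_C, one_pow, one_mul,
      mul_one, ← halg] at this
    linear_combination this
  have hval (h : MvPolynomial (Fin 3) k) :
      ψ h = Polynomial.aeval (ψ (X 2)) (affineParam d μ h) := by
    refine DFunLike.congr_fun (f := ψ) (g := ((Polynomial.aeval (R := k) (ψ (X 2))).comp
      (affineParam d μ)).toRingHom) (MvPolynomial.ringHom_ext (fun c => ?_) fun i => ?_) h
    · simp [hψ.map_C, halg]
    · fin_cases i
      · simp [hψ.map_X_zero]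
      · simp [h1]
      · simp
  have hinj : Function.Injective (Polynomial.aeval (R := k) (ψ (X 2))) := by
    refine (injective_iff_map_eq_zero _).mpr fun p hp => ?_
    obtain ⟨m, h, hh, rfl⟩ := exists_isHomogeneous_affineParam_eq d μ p
    rw [← hval, hψ.eq_zero_iff hh, hη, Ideal.mem_span_singleton] at hp
    obtain ⟨c, rfl⟩ := hp
    rw [map_mul, affineParam_curveEq, zero_mul]
  refine ⟨fun x => inferInstance, fun x => HomogeneousIdeal.isHomogeneous _, hH.mem_primeAt,
    fun x => ?_, fun x y h => hH.eq_of_primeAt_eq h, ?_, hinj, fun e => ?_, ?_, ?_⟩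
  · by_contra! hall
    refine (j x : ProjectiveSpectrum (grading k 2)).not_irrelevant_le fun h hh => ?_
    have hspan : Ideal.span (X '' Set.univ) ≤ primeAt (j x) := by
      rw [Ideal.span_le]
      rintro _ ⟨i, -, rfl⟩
      exact hall i
    refine hspan (mem_ideal_span_X_image.mpr fun m hm => ?_)
    by_contra! hm0
    obtain rfl : m = 0 := Finsupp.ext fun i => hm0 i trivial
    refine mem_support_iff.mp hm ?_
    have h0 : homogeneousComponent 0 h = 0 := by
      rw [← decomposition.decompose'_apply]
      exact (HomogeneousIdeal.mem_irrelevant_iff _ _).mp hh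
    rwa [homogeneousComponent_zero, C_eq_zero] at h0
  · intro Q hQ hhom hF i hi
    exact hH.exists_point Q hQ hhom hF hi
  · obtain ⟨x⟩ : Nonempty H := inferInstance
    obtain ⟨a, b, hb, rfl⟩ := IsFractionRing.div_surjective (A := H.presheaf.stalk x) e
    obtain ⟨m, h, w, hh, hw, hwx, ha⟩ := hψ.exists_frac _ a
    obtain ⟨m', h', w', hh', hw', hwx', hb'⟩ := hψ.exists_frac _ b
    have hw0 := (hψ.exists_stalk _ hh hw hwx).1
    have hw0' := (hψ.exists_stalk _ hh' hw' hwx').1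
    have hb0 : algebraMap _ H.functionField b ≠ 0 := by
      simpa using nonZeroDivisors.ne_zero hb
    rw [hb'] at hb0
    have hh0' : ψ h' ≠ 0 := (div_ne_zero_iff.mp hb0).1
    refine ⟨affineParam d μ (h * w'), affineParam d μ (w * h'), fun h0 => ?_, ?_⟩
    · refine mul_ne_zero hw0 hh0' ?_
      rw [← map_mul, hval, h0, map_zero]
    · rw [← hval, ← hval, ha, hb', map_mul, map_mul]
      field_simp
  · intro x m h w hh hw hwx
    obtain ⟨hw0, e, he, hunit⟩ := hψ.exists_stalk x hh hw hwx
    rw [← hval, ← hval]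
    refine ⟨hw0, ⟨e, he⟩, ?_⟩
    rw [← he, localNonunits, (IsFractionRing.injective _ _).mem_set_image, mem_nonunits_iff, hunit,
      not_not]
  · rintro x _ ⟨e, rfl⟩
    obtain ⟨m, h, w, hh, hw, hwx, he⟩ := hψ.exists_frac x e
    exact ⟨m, h, w, hh, hw, hwx, by rw [he, hval h, hval w]⟩

end CoordinateHom

lemma IsHypersurface.iso_comp {k : Type} [Field k] {n : ℕ} {F : MvPolynomial (Fin (n + 1)) k}
    {H H' : Scheme} {j : H' ⟶ ProjSpace k n} (hH : IsHypersurface F H' j) (α : H ≅ H') :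
    IsHypersurface F H (α.hom ≫ j) where
  isClosedImmersion := by
    have := hH.isClosedImmersion
    infer_instance
  reduced := by
    have := hH.reduced
    exact isReduced_of_isOpenImmersion α.hom
  range_eq := by
    rw [← hH.range_eq]
    exact (Scheme.Hom.surjective α.hom).range_comp j

lemma IsHypersurface.exists_isCurveModel {k : Type} [Field k] {H : Scheme} [IsIntegral H] {d : ℕ}
    {μ : k} (hd : 4 ≤ d) {j : H ⟶ ProjSpace k 2} (hH : IsHypersurface (curveEq d μ) H j)
    (hη : primeAt (j (genericPoint H)) = Ideal.span {curveEq d μ})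
    [Algebra k H.functionField] (halg : ∀ c, algebraMap k H.functionField c =
      constGerm (j ≫ projStruct k 2) (genericPoint H) c) :
    ∃ t, IsCurveModel d μ (localSubring (H := H)) localNonunits (fun x => primeAt (j x)) t := by
  have := hH.isClosedImmersion
  obtain ⟨ψ, hψ⟩ := exists_isCoordinateHom j fun h => not_curveEq_dvd_X_zero hd μ <|
    Ideal.mem_span_singleton.mp (hη ▸ h)
  exact ⟨_, hψ.isCurveModel hd hH hη halg⟩

/-- **Lemma 3.8.**  Let `d ≥ 4` not be a multiple of `char k`, let `μ ∈ k` and let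
`f = x^{d-1} y + z^d`, `g = x^{d-1} y + z^d + μ x^{d-2} z^2` in `k[x, y, z]`
(`x = x_0`, `y = x_1`, `z = x_2`).  If `α : V(f) ≅ V(g)` is an isomorphism of the
curves `V(f), V(g) ⊆ ℙ²`, then `μ = 0` and `α` is the map
`[x : y : z] ↦ [a^d x : y : a^{d-1} z]` for some `a ∈ k*` (on points, `α` contracts
homogeneous ideals along the substitution `x ↦ a^d x, y ↦ y, z ↦ a^{d-1} z`). -/
theorem stmt11 (k : Type) [Field k] (d : ℕ) (hd : 4 ≤ d)
    (hchar : ¬ (ringChar k ∣ d)) (μ : k)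
    (H H' : Scheme) (ι : H ⟶ ProjSpace k 2) (ι' : H' ⟶ ProjSpace k 2)
    (hH : IsHypersurface (X 0 ^ (d - 1) * X 1 + X 2 ^ d) H ι)
    (hH' : IsHypersurface
      (X 0 ^ (d - 1) * X 1 + X 2 ^ d + C μ * X 0 ^ (d - 2) * X 2 ^ 2) H' ι')
    (α : H ≅ H') (hα : α.hom ≫ ι' ≫ projStruct k 2 = ι ≫ projStruct k 2) :
    μ = 0 ∧
    ∃ a : k, a ≠ 0 ∧
      ∀ x : H,
        ((ι'.base (α.hom.base x)) :
            ProjectiveSpectrum (grading k 2)).asHomogeneousIdeal.toIdeal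
          = Ideal.comap
              (aeval (![C (a ^ d) * X 0, X 1, C (a ^ (d - 1)) * X 2] :
                Fin 3 → MvPolynomial (Fin (2 + 1)) k))
              (((ι.base x) : ProjectiveSpectrum (grading k 2)).asHomogeneousIdeal.toIdeal) := by
  have hF : (X 0 ^ (d - 1) * X 1 + X 2 ^ d : MvPolynomial (Fin 3) k) = curveEq d 0 := by
    simp [curveEq]
  have hJ : IsHypersurface (curveEq d 0) H ι := hF ▸ hH
  have hJ' : IsHypersurface (curveEq d μ) H (α.hom ≫ ι') := hH'.iso_comp α
  obtain ⟨hint, hη⟩ := hJ.isIntegral (prime_curveEq hd 0) (isHomogeneous_curveEq (by omega) 0)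
    (not_curveEq_dvd_X_zero hd 0)
  obtain ⟨-, hη'⟩ := hJ'.isIntegral (prime_curveEq hd μ) (isHomogeneous_curveEq (by omega) μ)
    (not_curveEq_dvd_X_zero hd μ)
  let := (constGerm (ι ≫ projStruct k 2) (genericPoint H)).toAlgebra
  obtain ⟨t, M⟩ := hJ.exists_isCurveModel hd (hη _ (genericPoint_spec H)) fun _ => rfl
  obtain ⟨t', M'⟩ := hJ'.exists_isCurveModel hd (hη' _ (genericPoint_spec H)) fun c => by
    rw [Category.assoc, hα]
    rfl
  obtain ⟨a, b, ha, ht'⟩ := M.exists_affine hd M'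
  obtain ⟨rfl, rfl⟩ := M.const_eq_zero hd (fun h => hchar ((ringChar.spec k d).mp h)) M' ha ht'
  rw [map_zero, add_zero] at ht'
  refine ⟨rfl, a⁻¹, inv_ne_zero ha, fun x => ?_⟩
  exact M.eq_comap hd M' ha ht' x

end
end
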